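/- arXiv:2208.05829 — 3 statements merged into one kernel-verified Lean document; each statement's English description precedes it below -/
import Mathlib

section
/- Let 0 < δ < 1 be a real number, let p ≥ 2 and b ≥ 1 be integers, let 1 ≤ a_1 ≤ a_2 ≤ … ≤ a_{p−1} ≤ b be integers, and set η = δ^{1/(a_1·a_2·⋯·a_{p−1})}. Let N be an integer with N ≥ max{p², b²/δ} and let a_p be a positive integer with a_p ≤ δN. If Γ is a graph on N vertices containing no copy of K_p(a_1, …, a_p), then the number of copies of K_p in Γ (p-element vertex subsets inducing a complete graph) is at most η·N^p. -/
open SimpleGraph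

/-- `Γ` contains a copy of `H` as a (not necessarily induced) subgraph. -/
def ContainsCopy {V W : Type*} (Γ : SimpleGraph V) (H : SimpleGraph W) : Prop :=
  ∃ f : W → V, Function.Injective f ∧ ∀ ⦃a b : W⦄, H.Adj a b → Γ.Adj (f a) (f b)

/-- The part sizes of `K_p(a_1, …, a_{p-1}, a_p)`: part `i` (0-indexed) has size `a i`
for `i < p - 1` and the last part has size `ap`. -/
def partSizes (p ap : ℕ) (a : ℕ → ℕ) : ℕ → ℕ := fun i => if i = p - 1 then ap else a i


open scoped Classical in
/-- The number of elements satisfying `Q`, divided by the size of the type. -/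
noncomputable def dn {X : Type} [Fintype X] (Q : X → Prop) : ℝ :=
  ((Finset.univ.filter Q).card : ℝ) / (Fintype.card X : ℝ)

lemma dn_nonneg {X : Type} [Fintype X] (Q : X → Prop) : 0 ≤ dn Q := by
  unfold dn; positivity

lemma dn_equiv {X Y : Type} [Fintype X] [Fintype Y] (e : X ≃ Y) (Q : X → Prop) (R : Y → Prop)
    (h : ∀ x, Q x ↔ R (e x)) : dn Q = dn R := by
  classical
  unfold dn
  rw [Fintype.card_congr e]
  congr 2
  apply Finset.card_bij (fun x _ => e x)
  · intro x hx
    simpa [← h] using hx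
  · intro x _ y _ hxy
    exact e.injective hxy
  · intro y hy
    refine ⟨e.symm y, ?_, by simp⟩
    simpa [h] using hy

lemma card_filter_prod {X Y : Type} [Fintype X] [Fintype Y] (P : X × Y → Prop) [DecidablePred P] :
    (Finset.univ.filter P).card = ∑ x : X, (Finset.univ.filter (fun y => P (x, y))).card := by
  simp only [Finset.card_filter]
  rw [Fintype.sum_prod_type]

/-- One blow-up step. -/
lemma dn_step {X Y : Type} [Fintype X] [Fintype Y] [Nonempty X] [Nonempty Y]
    (a : ℕ) (ha : 1 ≤ a) (P : X → Y → Prop) :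
    (dn (fun z : Y × X => P z.2 z.1)) ^ a ≤
      dn (fun z : Y × (Fin a → X) => ∀ k, P (z.2 k) z.1) := by
  classical
  obtain ⟨c, rfl⟩ : ∃ c, a = c + 1 := ⟨a - 1, by omega⟩
  unfold dn
  rw [card_filter_prod, card_filter_prod]
  have h2 : ∀ y : Y, (Finset.univ.filter (fun s : Fin (c+1) → X => ∀ k, P (s k) y)).card
      = (Finset.univ.filter (fun x => P x y)).card ^ (c+1) := by
    intro y
    have : (Finset.univ.filter (fun s : Fin (c+1) → X => ∀ k, P (s k) y))
        = Fintype.piFinset (fun _ => Finset.univ.filter (fun x => P x y)) := by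
      ext s; simp
    rw [this]; simp
  simp only [h2]
  have hX : (0:ℝ) < Fintype.card X := by exact_mod_cast Fintype.card_pos
  have hY : (0:ℝ) < Fintype.card Y := by exact_mod_cast Fintype.card_pos
  have key := pow_sum_div_card_le_sum_pow (s := (Finset.univ : Finset Y))
    (f := fun y => ((Finset.univ.filter (fun x => P x y)).card : ℝ))
    (fun _ _ => by positivity) c
  simp only [Finset.card_univ] at key
  rw [div_le_iff₀ (by positivity)] at key
  simp only [Fintype.card_prod, Fintype.card_fun, Fintype.card_fin]
  push_cast
  rw [div_pow, div_le_div_iff₀ (by positivity) (by positivity)]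
  refine le_trans (mul_le_mul_of_nonneg_right key (by positivity)) (le_of_eq ?_)
  ring

/-- Splitting off the first coordinate. -/
def shift1 (V W : Type) (r : ℕ) : ((Fin r → V) × W) × V ≃ (Fin (r+1) → V) × W where
  toFun z := (Fin.cons z.2 z.1.1, z.1.2)
  invFun z := ((Fin.tail z.1, z.2), z.1 0)
  left_inv := by rintro ⟨⟨x, w⟩, v⟩; simp
  right_inv := by rintro ⟨x, w⟩; simp

/-- Splitting off the first coordinate, dependent version. -/
def shift2 (W : Type) (r : ℕ) (β : Fin (r+1) → Type) :
    (∀ j : Fin r, β j.succ) × (W × β 0) ≃ (∀ j, β j) × W where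
  toFun z := (Fin.cons z.2.2 z.1, z.2.1)
  invFun z := (Fin.tail z.1, (z.2, z.1 0))
  left_inv := by rintro ⟨x, w, v⟩; simp
  right_inv := by rintro ⟨x, w⟩; simp

/-- Iterated blow-up. -/
lemma dn_iter {V : Type} [Fintype V] [Nonempty V] (r : ℕ) :
    ∀ (W : Type) [Fintype W] [Nonempty W] (a : Fin r → ℕ) (_ : ∀ j, 1 ≤ a j)
      (P : (Fin r → V) → W → Prop),
    (dn (fun z : (Fin r → V) × W => P z.1 z.2)) ^ (∏ j, a j) ≤
      dn (fun z : (∀ j, Fin (a j) → V) × W =>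
        ∀ k : (∀ j, Fin (a j)), P (fun j => z.1 j (k j)) z.2) := by
  induction r with
  | zero =>
    intro W _ _ a ha P
    simp only [Finset.univ_eq_empty, Finset.prod_empty, pow_one]
    apply le_of_eq
    refine dn_equiv (Equiv.prodCongr (Equiv.ofUnique _ _) (Equiv.refl _)) _ _ ?_
    intro z
    constructor
    · intro h k
      exact (congrArg (fun q => P q z.2) (Subsingleton.elim _ _)).mp h
    · intro h
      exact (congrArg (fun q => P q z.2) (Subsingleton.elim _ _)).mp (h (fun j => j.elim0))
  | succ r ih =>
    intro W _ _ a ha P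
    rw [Fin.prod_univ_succ, pow_mul]
    have h1 := dn_step (X := V) (Y := (Fin r → V) × W) (a 0) (ha 0)
      (fun x y => P (Fin.cons x y.1) y.2)
    have h2 := ih (W × (Fin (a 0) → V)) (fun j => a j.succ) (fun j => ha _)
      (fun x w => ∀ k, P (Fin.cons (w.2 k) x) w.1)
    have e1 : dn (fun z : (Fin (r+1) → V) × W => P z.1 z.2) =
        dn (fun z : ((Fin r → V) × W) × V => P (Fin.cons z.2 z.1.1) z.1.2) := by
      symm
      exact dn_equiv (shift1 V W r) _ _ (fun z => Iff.rfl)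
    have e2 : dn (fun z : ((Fin r → V) × W) × (Fin (a 0) → V) =>
          ∀ k, P (Fin.cons (z.2 k) z.1.1) z.1.2) =
        dn (fun z : (Fin r → V) × (W × (Fin (a 0) → V)) =>
          ∀ k, P (Fin.cons (z.2.2 k) z.1) z.2.1) := by
      refine dn_equiv (Equiv.prodAssoc _ _ _) _ _ ?_
      intro z
      rfl
    have e3 : dn (fun z : (∀ j : Fin r, Fin (a j.succ) → V) × (W × (Fin (a 0) → V)) =>
          ∀ k' : (∀ j : Fin r, Fin (a j.succ)),
            ∀ k, P (Fin.cons (z.2.2 k) (fun j => z.1 j (k' j))) z.2.1) =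
        dn (fun z : (∀ j, Fin (a j) → V) × W =>
          ∀ k : (∀ j, Fin (a j)), P (fun j => z.1 j (k j)) z.2) := by
      refine dn_equiv (shift2 W r (fun j => Fin (a j) → V)) _ _ ?_
      rintro ⟨S, w, s⟩
      change (∀ k' : (∀ j : Fin r, Fin (a j.succ)),
            ∀ k, P (Fin.cons (s k) (fun j => S j (k' j))) w) ↔
          ∀ k : (∀ j, Fin (a j)),
            P (fun j => (Fin.cons (α := fun j => Fin (a j) → V) s S : ∀ j, Fin (a j) → V) j (k j)) w
      constructor
      · intro h k
        have := h (fun j => k j.succ) (k 0)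
        convert this using 1
        funext j
        refine Fin.cases ?_ (fun j => ?_) j <;> simp
      · intro h k' k
        have := h (Fin.cons (α := fun j => Fin (a j)) k k')
        convert this using 1
        funext j
        refine Fin.cases ?_ (fun j => ?_) j <;> simp
    rw [e1, ← e3]
    refine le_trans ?_ h2
    rw [← e2]
    exact pow_le_pow_left₀ (pow_nonneg (dn_nonneg _) _) h1 _

/-- few coincidences -/
lemma card_coincide {V : Type} [Fintype V] [DecidableEq V] (r : ℕ) (a : Fin r → ℕ) (j : Fin r)
    (k l : Fin (a j)) (hkl : k ≠ l) :
    (Finset.univ.filter (fun S : (∀ j, Fin (a j) → V) => S j k = S j l)).card * Fintype.card V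
      ≤ Fintype.card (∀ j, Fin (a j) → V) := by
  rw [← Finset.card_univ (α := V), ← Finset.card_product, ← Finset.card_univ]
  apply Finset.card_le_card_of_injOn
    (fun z => Function.update z.1 j (Function.update (z.1 j) k z.2))
  · intro z _; simp
  · rintro ⟨S, v⟩ hS ⟨T, w⟩ hT h
    simp only [Finset.coe_product, Set.mem_prod, Finset.coe_filter, Set.mem_ofPred_eq,
      Finset.mem_univ, true_and, Finset.coe_univ, Set.mem_univ, and_true] at hS hT
    dsimp only at h
    have hj := congrFun h j
    simp only [Function.update_self] at hj
    have hvw : v = w := by simpa using congrFun hj k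
    have hST : S = T := by
      funext i
      by_cases hi : i = j
      · subst hi
        have hl : S i l = T i l := by
          simpa [Function.update_of_ne hkl.symm] using congrFun hj l
        funext m
        by_cases hm : m = k
        · subst hm; rw [hS, hT, hl]
        · simpa [Function.update_of_ne hm] using congrFun hj m
      · simpa [Function.update_of_ne hi] using congrFun h i
    rw [hvw, hST]

/-- the ordered clique relation -/
def CliqueRel {V : Type} (Γ : SimpleGraph V) (r : ℕ) (x : Fin r → V) (w : V) : Prop :=
  (∀ i j, i ≠ j → Γ.Adj (x i) (x j)) ∧ ∀ i, Γ.Adj (x i) w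

open scoped Classical in
lemma ordered_count {N : ℕ} (Γ : SimpleGraph (Fin N)) (r : ℕ) :
    {t : Finset (Fin N) | Γ.IsNClique (r+1) t}.ncard * (r+1).factorial ≤
      (Finset.univ.filter (fun z : (Fin r → Fin N) × Fin N => CliqueRel Γ r z.1 z.2)).card := by
  have h0 : {t : Finset (Fin N) | Γ.IsNClique (r+1) t}.ncard =
      Fintype.card {t : Finset (Fin N) // Γ.IsNClique (r+1) t} := by
    rw [← Nat.card_eq_fintype_card]; rfl
  have h1 : (r+1).factorial = Fintype.card (Equiv.Perm (Fin (r+1))) := by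
    rw [Fintype.card_perm, Fintype.card_fin]
  rw [h0, h1, ← Fintype.card_prod, ← Fintype.card_subtype]
  let g : {t : Finset (Fin N) // Γ.IsNClique (r+1) t} × Equiv.Perm (Fin (r+1)) →
      Fin (r+1) → Fin N := fun z i => z.1.1.orderEmbOfFin z.1.2.card_eq (z.2 i)
  have hadj : ∀ z i j, i ≠ j → Γ.Adj (g z i) (g z j) := by
    intro z i j hij
    apply z.1.2.isClique
    · exact Finset.orderEmbOfFin_mem _ _ _
    · exact Finset.orderEmbOfFin_mem _ _ _
    · intro h
      exact hij (z.2.injective ((Finset.orderEmbOfFin _ _).injective h))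
  have hrange : ∀ z, Set.range (g z) = (z.1.1 : Set (Fin N)) := by
    intro z
    rw [← Finset.range_orderEmbOfFin z.1.1 z.1.2.card_eq]
    exact z.2.surjective.range_comp (z.1.1.orderEmbOfFin z.1.2.card_eq)
  have hginj : Function.Injective g := by
    rintro ⟨⟨t, ht⟩, σ⟩ ⟨⟨u, hu⟩, τ⟩ h
    have htu : t = u := by
      apply Finset.coe_injective
      rw [← hrange ⟨⟨t, ht⟩, σ⟩, h, hrange]
    subst htu
    have : σ = τ := by
      ext1 i
      exact (Finset.orderEmbOfFin _ _).injective (congrFun h i)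
    rw [this]
  refine Fintype.card_le_of_injective
    (fun z => ⟨(fun i => g z i.castSucc, g z (Fin.last r)), ?_, ?_⟩) ?_
  · intro i j hij
    exact hadj z _ _ (fun h => hij (Fin.castSucc_injective _ h))
  · intro i
    exact hadj z _ _ (Fin.castSucc_lt_last i).ne
  · intro z w h
    apply hginj
    have h := congrArg Subtype.val h
    have hf := congrArg Prod.fst h
    have hs := congrArg Prod.snd h
    funext i
    refine Fin.lastCases ?_ (fun i => ?_) i
    · exact hs
    · exact congrFun hf i

/-- Building a copy of the complete multipartite graph. -/
lemma build_copy {V : Type} (Γ : SimpleGraph V) (r ap : ℕ) (a : ℕ → ℕ)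
    (ha : ∀ j, j < r → 1 ≤ a j)
    (S : ∀ j : Fin r, Fin (a j) → V) (hS : ∀ j, Function.Injective (S j))
    (e : Fin ap → V) (he : Function.Injective e) (hap : 1 ≤ ap)
    (hadj : ∀ m, ∀ k : (∀ j : Fin r, Fin (a j)), CliqueRel Γ r (fun j => S j (k j)) (e m)) :
    ContainsCopy Γ
      (completeMultipartiteGraph fun i : Fin (r+1) => Fin (partSizes (r+1) ap a i.val)) := by
  classical
  have hSS : ∀ i j : Fin r, i ≠ j → ∀ k l, Γ.Adj (S i k) (S j l) := by
    intro i j hij k l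
    let k0 : ∀ j : Fin r, Fin (a j) := fun j => ⟨0, ha j j.2⟩
    have := (hadj ⟨0, hap⟩ (Function.update (Function.update k0 i k) j l)).1 i j hij
    simpa [Function.update_of_ne hij] using this
  have hSe : ∀ i : Fin r, ∀ k m, Γ.Adj (S i k) (e m) := by
    intro i k m
    let k0 : ∀ j : Fin r, Fin (a j) := fun j => ⟨0, ha j j.2⟩
    have := (hadj m (Function.update k0 i k)).2 i
    simpa using this
  have hg : ∀ i : Fin (r+1), ∃ g : Fin (partSizes (r+1) ap a i.val) → V,
      Function.Injective g ∧ (∀ h : i.val < r, ∀ k, ∃ k', g k = S ⟨i.val, h⟩ k') ∧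
      (¬ i.val < r → ∀ k, ∃ m, g k = e m) := by
    intro i
    by_cases h : i.val < r
    · have hs : partSizes (r+1) ap a i.val = a i.val := by
        unfold partSizes; rw [if_neg (by omega)]
      refine ⟨fun k => S ⟨i.val, h⟩ (Fin.cast hs k), ?_, ?_, ?_⟩
      · intro k l hkl
        exact Fin.cast_injective hs (hS _ hkl)
      · intro _ k
        exact ⟨_, rfl⟩
      · intro h'; exact absurd h h'
    · have hs : partSizes (r+1) ap a i.val = ap := by
        unfold partSizes; rw [if_pos (by omega)]
      refine ⟨fun k => e (Fin.cast hs k), ?_, ?_, ?_⟩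
      · intro k l hkl
        exact Fin.cast_injective hs (he hkl)
      · intro h'; exact absurd h' h
      · intro _ k
        exact ⟨_, rfl⟩
  choose g hginj hg1 hg2 using hg
  have hA : ∀ i j, i ≠ j → ∀ k l, Γ.Adj (g i k) (g j l) := by
    intro i j hij k l
    have hij' : i.val ≠ j.val := fun h => hij (Fin.ext h)
    by_cases hi : i.val < r <;> by_cases hj : j.val < r
    · obtain ⟨k', hk⟩ := hg1 i hi k
      obtain ⟨l', hl⟩ := hg1 j hj l
      rw [hk, hl]
      exact hSS _ _ (fun h => hij' (by simpa using h)) _ _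
    · obtain ⟨k', hk⟩ := hg1 i hi k
      obtain ⟨l', hl⟩ := hg2 j hj l
      rw [hk, hl]
      exact hSe _ _ _
    · obtain ⟨k', hk⟩ := hg2 i hi k
      obtain ⟨l', hl⟩ := hg1 j hj l
      rw [hk, hl]
      exact (hSe _ _ _).symm
    · omega
  refine ⟨fun z => g z.1 z.2, ?_, ?_⟩
  · rintro ⟨i, k⟩ ⟨j, l⟩ h
    by_cases hij : i = j
    · subst hij
      exact congrArg (Sigma.mk i) (hginj i h)
    · exact absurd h (hA i j hij k l).ne
  · rintro ⟨i, k⟩ ⟨j, l⟩ h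
    exact hA i j h k l

open scoped Classical in
/-- Few tuples fail to be injective on some part. -/
lemma card_noninj {V : Type} [Fintype V] (r b : ℕ) (a : Fin r → ℕ) (hab : ∀ j, a j ≤ b) :
    (Finset.univ.filter (fun S : (∀ j, Fin (a j) → V) =>
        ¬ ∀ j, Function.Injective (S j))).card * Fintype.card V
      ≤ r * b ^ 2 * Fintype.card (∀ j, Fin (a j) → V) := by
  let I : Finset (Σ j : Fin r, Fin (a j) × Fin (a j)) :=
    Finset.univ.filter (fun z => z.2.1 ≠ z.2.2)
  have hsub : (Finset.univ.filter (fun S : (∀ j, Fin (a j) → V) =>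
        ¬ ∀ j, Function.Injective (S j))) ⊆
      I.biUnion (fun z => Finset.univ.filter
        (fun S : (∀ j, Fin (a j) → V) => S z.1 z.2.1 = S z.1 z.2.2)) := by
    intro S hS
    simp only [Finset.mem_filter, Finset.mem_univ, true_and, not_forall,
      Function.Injective] at hS
    obtain ⟨j, k, l, h, hkl⟩ := hS
    simp only [Finset.mem_biUnion, Finset.mem_filter, Finset.mem_univ, true_and]
    exact ⟨⟨j, k, l⟩, by simp [I, hkl], h⟩
  have hI : I.card ≤ r * b ^ 2 := by
    refine (Finset.card_le_univ I).trans ?_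
    rw [Fintype.card_sigma]
    calc ∑ j : Fin r, Fintype.card (Fin (a j) × Fin (a j)) ≤ ∑ j : Fin r, b ^ 2 := by
          apply Finset.sum_le_sum
          intro j _
          rw [Fintype.card_prod, Fintype.card_fin, sq]
          exact Nat.mul_le_mul (hab j) (hab j)
      _ = r * b ^ 2 := by simp
  calc _ ≤ (∑ z ∈ I, (Finset.univ.filter
        (fun S : (∀ j, Fin (a j) → V) => S z.1 z.2.1 = S z.1 z.2.2)).card) * Fintype.card V :=
        Nat.mul_le_mul_right _ ((Finset.card_le_card hsub).trans Finset.card_biUnion_le)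
    _ = ∑ z ∈ I, (Finset.univ.filter
        (fun S : (∀ j, Fin (a j) → V) => S z.1 z.2.1 = S z.1 z.2.2)).card * Fintype.card V := by
        rw [Finset.sum_mul]
    _ ≤ ∑ z ∈ I, Fintype.card (∀ j, Fin (a j) → V) := by
        apply Finset.sum_le_sum
        intro z hz
        refine card_coincide r a z.1 z.2.1 z.2.2 ?_
        simpa [I] using hz
    _ ≤ _ := by
        rw [Finset.sum_const, smul_eq_mul]
        exact Nat.mul_le_mul_right _ hI

lemma dn_noninj {V : Type} [Fintype V] [Nonempty V] (r b : ℕ) (a : Fin r → ℕ)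
    (hab : ∀ j, a j ≤ b) (δ : ℝ) (h : (b:ℝ)^2 ≤ δ * Fintype.card V) :
    dn (fun S : (∀ j, Fin (a j) → V) => ¬ ∀ j, Function.Injective (S j)) ≤ r * δ := by
  classical
  have h1 := card_noninj (V := V) r b a hab
  have hV : (0:ℝ) < Fintype.card V := by exact_mod_cast Fintype.card_pos
  have hT : (0:ℝ) < Fintype.card (∀ j, Fin (a j) → V) := by exact_mod_cast Fintype.card_pos
  unfold dn
  rw [div_le_iff₀ hT]
  suffices hs : ((Finset.univ.filter (fun S : (∀ j, Fin (a j) → V) =>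
        ¬ ∀ j, Function.Injective (S j))).card : ℝ) ≤
      r * δ * (Fintype.card (∀ j, Fin (a j) → V) : ℝ) by
    refine le_trans (le_of_eq ?_) hs
    congr!
  replace h1 : (Finset.univ.filter (fun S : (∀ j, Fin (a j) → V) =>
        ¬ ∀ j, Function.Injective (S j))).card * Fintype.card V
      ≤ r * b ^ 2 * Fintype.card (∀ j, Fin (a j) → V) := by
    convert h1
  generalize Fintype.card (∀ j, Fin (a j) → V) = T at *
  generalize Finset.card _ = M at *
  generalize Fintype.card V = n at *
  have h2 : (M:ℝ) * n ≤ r * b^2 * T := by exact_mod_cast h1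
  have h3 : (r:ℝ) * b^2 * T ≤ r * (δ * n) * T := by gcongr
  refine le_of_mul_le_mul_right ?_ hV
  linarith

lemma dn_upper {X V : Type} [Fintype X] [Fintype V] [Nonempty X] [Nonempty V]
    (Q : X → V → Prop) (Good : X → Prop) (ap : ℕ) (δ ε : ℝ)
    (hap : (ap:ℝ) ≤ δ * Fintype.card V)
    (hgood : ∀ x, Good x → ∀ B : Finset V, (∀ v ∈ B, Q x v) → B.card ≤ ap)
    (hbad : dn (fun x => ¬ Good x) ≤ ε) :
    dn (fun z : X × V => Q z.1 z.2) ≤ δ + ε := by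
  classical
  have hV : (0:ℝ) < Fintype.card V := by exact_mod_cast Fintype.card_pos
  have hX : (0:ℝ) < Fintype.card X := by exact_mod_cast Fintype.card_pos
  unfold dn at hbad ⊢
  rw [div_le_iff₀ hX] at hbad
  rw [card_filter_prod, Fintype.card_prod, Nat.cast_mul, div_le_iff₀ (by positivity)]
  have h1 : ∀ x, (Finset.univ.filter (fun v => Q x v)).card ≤
      ap + if ¬ Good x then Fintype.card V else 0 := by
    intro x
    by_cases h : Good x
    · rw [if_neg (not_not.2 h)]
      exact hgood x h _ (by simp)
    · rw [if_pos h]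
      exact (Finset.card_le_univ _).trans (Nat.le_add_left _ _)
  have h2 : ∑ x, (Finset.univ.filter (fun v => Q x v)).card ≤
      Fintype.card X * ap + (Finset.univ.filter (fun x => ¬ Good x)).card * Fintype.card V := by
    refine (Finset.sum_le_sum (fun x _ => h1 x)).trans (le_of_eq ?_)
    rw [Finset.sum_add_distrib, Finset.sum_const, ← Finset.sum_filter, Finset.sum_const,
      Finset.card_univ, smul_eq_mul, smul_eq_mul]
  have h3 : ((∑ x, (Finset.univ.filter (fun v => Q x v)).card : ℕ) : ℝ) ≤
      Fintype.card X * ap + (Finset.univ.filter (fun x => ¬ Good x)).card * Fintype.card V := by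
    exact_mod_cast h2
  refine h3.trans ?_
  have h4 := mul_le_mul_of_nonneg_left hap hX.le
  have hbad' : ((Finset.univ.filter (fun x => ¬ Good x)).card : ℝ) ≤ ε * Fintype.card X := by
    refine le_trans (le_of_eq ?_) hbad
    congr!
  have h5 := mul_le_mul_of_nonneg_right hbad' hV.le
  linarith

theorem supersaturation_erdos (δ : ℝ) (hδ0 : 0 < δ) (hδ1 : δ < 1)
    (p b : ℕ) (hp : 2 ≤ p) (hb : 1 ≤ b)
    (a : ℕ → ℕ) (ha1 : 1 ≤ a 0)
    (hmono : ∀ i j, i ≤ j → j < p - 1 → a i ≤ a j)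
    (hab : ∀ i, i < p - 1 → a i ≤ b)
    (A : ℕ) (hA : A = ∏ i ∈ Finset.range (p - 1), a i)
    (N : ℕ) (hN1 : p ^ 2 ≤ N) (hN2 : ((b : ℝ) ^ 2) / δ ≤ N)
    (ap : ℕ) (hap1 : 1 ≤ ap) (hap : (ap : ℝ) ≤ δ * N)
    (Γ : SimpleGraph (Fin N))
    (hfree : ¬ ContainsCopy Γ
      (completeMultipartiteGraph fun i : Fin p => Fin (partSizes p ap a i.val))) :
    ({t : Finset (Fin N) | Γ.IsNClique p t}.ncard : ℝ) ≤ δ ^ ((A : ℝ))⁻¹ * N ^ p := by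
  classical
  obtain ⟨r, rfl⟩ : ∃ r, p = r + 1 := ⟨p - 1, by omega⟩
  simp only [Nat.add_sub_cancel] at hmono hab hA
  have ha : ∀ j, j < r → 1 ≤ a j := fun j hj => ha1.trans (hmono 0 j (Nat.zero_le _) hj)
  have hNpos : 0 < N := lt_of_lt_of_le (by positivity) hN1
  have hNR : (0:ℝ) < N := by exact_mod_cast hNpos
  have : Nonempty (Fin N) := ⟨⟨0, hNpos⟩⟩
  have hA1 : 1 ≤ A := by
    rw [hA]
    exact Finset.prod_pos (f := a) (fun i hi => ha i (Finset.mem_range.1 hi))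
  by_contra hcon
  push Not at hcon
  set K := {t : Finset (Fin N) | Γ.IsNClique (r+1) t}.ncard with hK
  set η : ℝ := δ ^ ((A : ℝ))⁻¹ with hη
  have hη0 : 0 < η := Real.rpow_pos_of_pos hδ0 _
  have hηA : η ^ A = δ := Real.rpow_inv_natCast_pow hδ0.le (by omega)
  -- lower bound
  have hlow : ((r:ℝ) + 1) * δ < dn (fun z : (∀ j : Fin r, Fin (a j) → Fin N) × Fin N =>
        ∀ k : (∀ j : Fin r, Fin (a j)), CliqueRel Γ r (fun j => z.1 j (k j)) z.2) := by
    refine lt_of_lt_of_le ?_ (dn_iter (V := Fin N) r (Fin N) (fun j => a j)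
      (fun j => ha j j.2) (CliqueRel Γ r))
    have hprod : ∏ j : Fin r, a j = A := by rw [hA, Finset.prod_range]
    rw [hprod]
    have h1 : ((r:ℝ) + 1) * η <
        dn (fun z : (Fin r → Fin N) × Fin N => CliqueRel Γ r z.1 z.2) := by
      unfold dn
      have hc := ordered_count Γ r
      have hf : (r + 1) ≤ (r+1).factorial := Nat.self_le_factorial _
      have hc' : K * (r+1) ≤ (Finset.univ.filter
          (fun z : (Fin r → Fin N) × Fin N => CliqueRel Γ r z.1 z.2)).card :=
        (Nat.mul_le_mul_left _ hf).trans hc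
      have hc'' : (K:ℝ) * (r+1) ≤ ((Finset.univ.filter
          (fun z : (Fin r → Fin N) × Fin N => CliqueRel Γ r z.1 z.2)).card : ℝ) := by
        exact_mod_cast hc'
      simp only [Fintype.card_prod, Fintype.card_fun, Fintype.card_fin]
      push_cast
      rw [lt_div_iff₀ (by positivity)]
      refine lt_of_lt_of_le ?_ hc''
      have := mul_lt_mul_of_pos_right hcon (show (0:ℝ) < r + 1 by positivity)
      calc ((r:ℝ)+1) * η * (N ^ r * N) = η * N ^ (r+1) * (r+1) := by ring
        _ < _ := this
    calc ((r:ℝ) + 1) * δ ≤ ((r:ℝ)+1)^A * δ := by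
          apply mul_le_mul_of_nonneg_right _ hδ0.le
          exact le_self_pow₀ (by linarith [(Nat.cast_nonneg r : (0:ℝ) ≤ r)]) (by omega)
      _ = (((r:ℝ)+1) * η) ^ A := by rw [mul_pow, hηA]
      _ < _ := pow_lt_pow_left₀ h1 (by positivity) (by omega)
  -- upper bound
  have hb2 : (b:ℝ)^2 ≤ δ * N := by
    rw [div_le_iff₀ hδ0] at hN2
    linarith
  have hbad := dn_noninj (V := Fin N) r b (fun j => a j) (fun j => hab j j.2) δ
    (by rw [Fintype.card_fin]; exact hb2)
  have hup := dn_upper (X := ∀ j : Fin r, Fin (a j) → Fin N) (V := Fin N)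
    (fun S w => ∀ k : (∀ j : Fin r, Fin (a j)), CliqueRel Γ r (fun j => S j (k j)) w)
    (fun S => ∀ j, Function.Injective (S j)) ap δ (r * δ)
    (by rw [Fintype.card_fin]; exact hap) (by
      intro S hS B hB
      by_contra hlt
      push Not at hlt
      apply hfree
      obtain ⟨C, hC, hCc⟩ := Finset.exists_subset_card_eq hlt.le
      refine build_copy Γ r ap a ha S hS (C.orderEmbOfFin hCc)
        (C.orderEmbOfFin hCc).injective hap1 ?_
      intro m
      exact hB _ (hC (Finset.orderEmbOfFin_mem C hCc m))) hbad
  have := lt_of_lt_of_le hlow hup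
  linarith
end

section
/- For every real ε > 0 and every integer p ≥ 2, set γ = min{1/(2p²), ε/2} and η = p^{−10p}·ε. Then for every integer N ≥ 10 the following holds. Suppose Γ is a graph on N vertices with minimum degree at least (1 − 1/(p−1) − γ)·N and with at most η·N^p copies of K_p. Then there is a partition of the vertex set of Γ into p−1 parts V_1, …, V_{p−1} such that: (i) the total number of edges inside the parts satisfies Σ_{i=1}^{p−1} e(V_i) ≤ ε·C(N,2); (ii) for each i, | |V_i| − N/(p−1) | ≤ √(2ε)·N; (iii) for all i < j, the number of edges between V_i and V_j satisfies e(V_i, V_j) ≥ (1 − p²ε)·|V_i|·|V_j|; and (iv) for each vertex v ∈ V_i and each j, the number of neighbors of v in V_i is at most the number of neighbors of v in V_j. -/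
open SimpleGraph

/-- The number of edges of `Γ` with both endpoints in `X`. -/
noncomputable def edgesIn {V : Type*} (Γ : SimpleGraph V) (X : Set V) : ℕ :=
  {e : Sym2 V | e ∈ Γ.edgeSet ∧ ∀ v ∈ e, v ∈ X}.ncard

/-- The number of edges of `Γ` with one endpoint in `X` and the other in `Y`
(counted as ordered pairs; for disjoint `X`, `Y` each such edge is counted once). -/
noncomputable def edgesBetween {V : Type*} (Γ : SimpleGraph V) (X Y : Set V) : ℕ :=
  {q : V × V | q.1 ∈ X ∧ q.2 ∈ Y ∧ Γ.Adj q.1 q.2}.ncard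

/-- The number of neighbors of `v` lying in `X`. -/
noncomputable def degIn {V : Type*} (Γ : SimpleGraph V) (X : Set V) (v : V) : ℕ :=
  {w | w ∈ X ∧ Γ.Adj v w}.ncard


/-- number of ordered `n`-cliques in `A` -/
def clq {V : Type*} [DecidableEq V] (G : SimpleGraph V) [DecidableRel G.Adj] : ℕ → Finset V → ℕ
  | 0, _ => 1
  | n + 1, A => ∑ x ∈ A, clq G n (A.filter (fun y => G.Adj x y))

theorem clq_le {V : Type*} [DecidableEq V] (G : SimpleGraph V) [DecidableRel G.Adj] (n : ℕ) :
    ∀ A : Finset V, clq G n A ≤ n.factorial * (A.powerset.filter (fun t => G.IsNClique n t)).card := by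
  induction n with
  | zero =>
    intro A
    simp only [clq, Nat.factorial_zero, one_mul]
    apply Finset.card_pos.mpr
    exact ⟨∅, by simp⟩
  | succ n ih =>
    intro A
    simp only [clq]
    calc _ ≤ ∑ x ∈ A, n.factorial * ((A.filter (fun y => G.Adj x y)).powerset.filter (fun t => G.IsNClique n t)).card :=
          Finset.sum_le_sum (fun x _ => ih _)
      _ = n.factorial * ∑ x ∈ A, ((A.filter (fun y => G.Adj x y)).powerset.filter (fun t => G.IsNClique n t)).card := by
          rw [Finset.mul_sum]
      _ ≤ n.factorial * ((n+1) * (A.powerset.filter (fun t => G.IsNClique (n+1) t)).card) := by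
          apply Nat.mul_le_mul_left
          rw [← Finset.card_sigma]
          have h2 : (n+1) * (A.powerset.filter (fun t => G.IsNClique (n+1) t)).card
              = ((A.powerset.filter (fun t => G.IsNClique (n+1) t)).sigma (fun t => t)).card := by
            rw [Finset.card_sigma, Finset.sum_const_nat (m := n+1), mul_comm]
            intro t ht
            exact (Finset.mem_filter.mp ht).2.card_eq
          rw [h2]
          apply Finset.card_le_card_of_injOn (fun q => (⟨insert q.1 q.2, q.1⟩ : (_ : Finset V) × V))
          · rintro ⟨x, t⟩ h
            simp only [Finset.coe_sigma, Set.mem_sigma_iff, Finset.mem_coe, Finset.mem_filter, Finset.mem_powerset] at h ⊢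
            obtain ⟨hx, ht, hc⟩ := h
            refine ⟨⟨?_, ?_⟩, Finset.mem_insert_self _ _⟩
            · intro y hy
              rcases Finset.mem_insert.mp hy with rfl | hy
              · exact hx
              · exact (Finset.mem_filter.mp (ht hy)).1
            · exact hc.insert (fun b hb => (Finset.mem_filter.mp (ht hb)).2)
          · rintro ⟨x, t⟩ h ⟨y, s⟩ h' heq
            simp only [Finset.coe_sigma, Set.mem_sigma_iff, Finset.mem_coe, Finset.mem_filter, Finset.mem_powerset] at h h'
            simp only [Sigma.mk.injEq] at heq
            obtain ⟨h1, h2⟩ := heq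
            have h2 : x = y := by simpa using h2
            subst h2
            have nx : x ∉ t := fun hh => G.loopless.irrefl x (Finset.mem_filter.mp (h.2.1 hh)).2
            have ny : x ∉ s := fun hh => G.loopless.irrefl x (Finset.mem_filter.mp (h'.2.1 hh)).2
            have : t = s := by
              rw [← Finset.erase_insert nx, ← Finset.erase_insert ny, h1]
            rw [this]
      _ = _ := by rw [Nat.factorial_succ]; ring

theorem top_set {V : Type*} [DecidableEq V] (A : Finset V) (d : V → ℕ) (m : ℕ) :
    m ≤ A.card → ∃ T ⊆ A, T.card = m ∧ ∀ t ∈ T, ∀ v ∈ A, v ∉ T → d v ≤ d t := by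
  induction m with
  | zero => intro _; exact ⟨∅, by simp⟩
  | succ m ih =>
    intro h
    obtain ⟨T, hT, hc, ht⟩ := ih (by omega)
    have hne : (A \ T).Nonempty := by
      rw [← Finset.card_pos, Finset.card_sdiff_of_subset hT]; omega
    obtain ⟨x, hx, hmax⟩ := Finset.exists_max_image (A \ T) d hne
    rw [Finset.mem_sdiff] at hx
    refine ⟨insert x T, Finset.insert_subset hx.1 hT, by rw [Finset.card_insert_of_notMem hx.2, hc], ?_⟩
    intro t htm v hv hvn
    rw [Finset.mem_insert, not_or] at hvn
    rcases Finset.mem_insert.mp htm with rfl | h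
    · exact hmax v (Finset.mem_sdiff.mpr ⟨hv, hvn.2⟩)
    · exact ht t h v hv hvn.2

/-- ordered pair counting -/
def pc {V : Type*} (X Y : Finset V) (P : V → V → Prop) [∀ u v, Decidable (P u v)] : ℕ :=
  ∑ u ∈ X, (Y.filter (fun v => P u v)).card

theorem pc_union_left {V : Type*} [DecidableEq V] (X X' Y : Finset V) (h : Disjoint X X') (P : V → V → Prop) [∀ u v, Decidable (P u v)] :
    pc (X ∪ X') Y P = pc X Y P + pc X' Y P := by
  unfold pc
  rw [Finset.sum_union h]

theorem pc_union_right {V : Type*} [DecidableEq V] (X Y Y' : Finset V) (h : Disjoint Y Y') (P : V → V → Prop) [∀ u v, Decidable (P u v)] :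
    pc X (Y ∪ Y') P = pc X Y P + pc X Y' P := by
  unfold pc
  rw [← Finset.sum_add_distrib]
  apply Finset.sum_congr rfl
  intro u _
  rw [Finset.filter_union, Finset.card_union_of_disjoint (Finset.disjoint_filter_filter h)]

theorem pc_symm {V : Type*} [DecidableEq V] (X Y : Finset V) (P : V → V → Prop) [∀ u v, Decidable (P u v)]
    (hP : ∀ u v, P u v → P v u) : pc X Y P = pc Y X P := by
  unfold pc
  simp only [Finset.card_filter]
  rw [Finset.sum_comm]
  apply Finset.sum_congr rfl
  intro u _
  apply Finset.sum_congr rfl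
  intro v _
  have : P v u ↔ P u v := ⟨hP _ _, hP _ _⟩
  simp [this]

theorem pc_congr {V : Type*} (X Y : Finset V) (P Q : V → V → Prop) [∀ u v, Decidable (P u v)]
    [∀ u v, Decidable (Q u v)] (h : ∀ u ∈ X, ∀ v ∈ Y, (P u v ↔ Q u v)) : pc X Y P = pc X Y Q := by
  unfold pc
  apply Finset.sum_congr rfl
  intro u hu
  congr 1
  apply Finset.filter_congr
  intro v hv
  exact h u hu v hv

theorem pc_mono {V : Type*} (X Y : Finset V) (P Q : V → V → Prop) [∀ u v, Decidable (P u v)]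
    [∀ u v, Decidable (Q u v)] (h : ∀ u ∈ X, ∀ v ∈ Y, (P u v → Q u v)) : pc X Y P ≤ pc X Y Q := by
  unfold pc
  apply Finset.sum_le_sum
  intro u hu
  apply Finset.card_le_card
  intro v hv
  rw [Finset.mem_filter] at hv ⊢
  exact ⟨hv.1, h u hu v hv.1 hv.2⟩

theorem pc_le {V : Type*} (X Y : Finset V) (P : V → V → Prop) [∀ u v, Decidable (P u v)] :
    pc X Y P ≤ X.card * Y.card := by
  unfold pc
  calc _ ≤ ∑ u ∈ X, Y.card := Finset.sum_le_sum (fun u _ => Finset.card_filter_le _ _)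
    _ = _ := by simp

theorem pc_full {V : Type*} (X Y : Finset V) (P : V → V → Prop) [∀ u v, Decidable (P u v)]
    (h : ∀ u ∈ X, ∀ v ∈ Y, P u v) :
    pc X Y P = X.card * Y.card := by
  unfold pc
  rw [Finset.sum_const_nat (m := Y.card)]
  intro u hu
  congr 1
  exact Finset.filter_true_of_mem (fun v hv => h u hu v hv)

theorem pc_zero {V : Type*} (X Y : Finset V) (P : V → V → Prop) [∀ u v, Decidable (P u v)]
    (h : ∀ u ∈ X, ∀ v ∈ Y, ¬ P u v) :
    pc X Y P = 0 := by
  unfold pc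
  apply Finset.sum_eq_zero
  intro u hu
  rw [Finset.card_eq_zero]
  exact Finset.filter_false_of_mem (fun v hv => h u hu v hv)

theorem pc_split {V : Type*} (X Y : Finset V) (P Q : V → V → Prop) [∀ u v, Decidable (P u v)]
    [∀ u v, Decidable (Q u v)] :
    pc X Y P = pc X Y (fun u v => P u v ∧ Q u v) + pc X Y (fun u v => P u v ∧ ¬ Q u v) := by
  unfold pc
  rw [← Finset.sum_add_distrib]
  apply Finset.sum_congr rfl
  intro u _
  rw [← Finset.card_filter_add_card_filter_not (s := Y.filter (fun v => P u v)) (fun v => Q u v),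
    Finset.filter_filter, Finset.filter_filter]

theorem top_sum {V : Type*} [DecidableEq V] [Fintype V] (A T W : Finset V) (d : V → ℕ) (s : ℕ)
    (hd : ∀ v, d v ≤ Fintype.card V) (hTc : T.card = s + 1)
    (htop : ∀ t ∈ T, ∀ v ∈ A, v ∉ T → d v ≤ d t) (x : V) (hx : x ∈ T) (hW : W ⊆ A) :
    ∑ v ∈ W, d v ≤ W.card * d x + s * Fintype.card V := by
  calc ∑ v ∈ W, d v ≤ ∑ v ∈ W, (d x + if v ∈ T.erase x then Fintype.card V else 0) := by
        apply Finset.sum_le_sum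
        intro v hv
        split_ifs with h
        · exact (hd v).trans (Nat.le_add_left _ _)
        · by_cases hvx : v = x
          · subst hvx; simp
          · have : v ∉ T := fun h' => h (Finset.mem_erase.mpr ⟨hvx, h'⟩)
            simpa using htop x hx v (hW hv) this
    _ = W.card * d x + (W.filter (fun v => v ∈ T.erase x)).card * Fintype.card V := by
        rw [Finset.sum_add_distrib, ← Finset.sum_filter]; simp
    _ ≤ _ := by
        gcongr
        calc _ ≤ (T.erase x).card := Finset.card_le_card (fun v hv => (Finset.mem_filter.mp hv).2)
          _ = s := by rw [Finset.card_erase_of_mem hx, hTc]; rfl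

theorem furedi {V : Type*} [DecidableEq V] [Fintype V] (G : SimpleGraph V) [DecidableRel G.Adj] (s k : ℕ) :
    ∀ A : Finset V, ∃ (c : V → ℕ) (ρ : ℕ), (∀ v ∈ A, c v < k + 1) ∧
      pc A A (fun u v => G.Adj u v) + pc A A (fun u v => G.Adj u v ∧ c u = c v)
        ≤ pc A A (fun u v => c u ≠ c v) + 2 * (k + 1) * s * Fintype.card V + 2 * ρ * Fintype.card V ∧
      ρ * (s + 1) ^ (k + 1) ≤ clq G (k + 2) A + s * (s + 1) ^ (k + 1) := by
  have small : ∀ (k : ℕ) (A : Finset V), A.card < s + 1 → ∃ (c : V → ℕ) (ρ : ℕ), (∀ v ∈ A, c v < k + 1) ∧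
      pc A A (fun u v => G.Adj u v) + pc A A (fun u v => G.Adj u v ∧ c u = c v)
        ≤ pc A A (fun u v => c u ≠ c v) + 2 * (k + 1) * s * Fintype.card V + 2 * ρ * Fintype.card V ∧
      ρ * (s + 1) ^ (k + 1) ≤ clq G (k + 2) A + s * (s + 1) ^ (k + 1) := by
    intro k A hA
    refine ⟨fun _ => 0, A.card, by simp, ?_, ?_⟩
    · refine le_trans (Nat.add_le_add (pc_le _ _ _) (pc_le _ _ _)) ?_
      have h3 : A.card * A.card ≤ A.card * Fintype.card V := Nat.mul_le_mul_left _ (Finset.card_le_univ A)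
      refine le_trans ?_ (Nat.le_add_left _ _)
      nlinarith
    · have : A.card ≤ s := by omega
      calc _ ≤ s * (s + 1) ^ (k + 1) := Nat.mul_le_mul_right _ this
        _ ≤ _ := Nat.le_add_left _ _
  induction k with
  | zero =>
    intro A
    rcases lt_or_ge A.card (s + 1) with h | h
    · exact small 0 A h
    set d : V → ℕ := fun v => (A.filter (fun y => G.Adj v y)).card with hd
    obtain ⟨T, hTA, hTc, htop⟩ := top_set A d (s + 1) h
    have hTne : T.Nonempty := by rw [← Finset.card_pos]; omega
    obtain ⟨x, hxT, hmin⟩ := Finset.exists_min_image T d hTne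
    have hdle : ∀ v, d v ≤ Fintype.card V := fun v => Finset.card_le_univ _
    have hs := top_sum A T A d s hdle hTc htop x hxT (le_refl _)
    refine ⟨fun _ => 0, d x, by simp, ?_, ?_⟩
    · have e1 : pc A A (fun u v => G.Adj u v) = ∑ v ∈ A, d v := rfl
      have e2 : pc A A (fun u v => G.Adj u v ∧ (fun _ : V => 0) u = (fun _ : V => 0) v) = ∑ v ∈ A, d v := by
        rw [← e1]; apply pc_congr; simp
      simp only at e2
      rw [e1]
      simp only [e2]
      have h3 : A.card * d x ≤ Fintype.card V * d x := Nat.mul_le_mul_right _ (Finset.card_le_univ A)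
      nlinarith
    · have : (s + 1) * d x ≤ clq G 2 A := by
        calc (s + 1) * d x = ∑ t ∈ T, d x := by simp [hTc]
          _ ≤ ∑ t ∈ T, d t := Finset.sum_le_sum hmin
          _ ≤ ∑ t ∈ A, d t := Finset.sum_le_sum_of_subset hTA
          _ = _ := by simp [clq, hd]
      simp only [zero_add, pow_one]
      nlinarith [Nat.zero_le (s * (s + 1))]
  | succ k ih =>
    intro A
    rcases lt_or_ge A.card (s + 1) with h | h
    · exact small (k + 1) A h
    set d : V → ℕ := fun v => (A.filter (fun y => G.Adj v y)).card with hd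
    obtain ⟨T, hTA, hTc, htop⟩ := top_set A d (s + 1) h
    have hTne : T.Nonempty := by rw [← Finset.card_pos]; omega
    obtain ⟨x, hxT, hmin⟩ := Finset.exists_min_image T (fun x => clq G (k + 2) (A.filter (fun y => G.Adj x y))) hTne
    have hdle : ∀ v, d v ≤ Fintype.card V := fun v => Finset.card_le_univ _
    set A2 := A.filter (fun y => G.Adj x y) with hA2
    set A1 := A.filter (fun y => ¬ G.Adj x y) with hA1
    have hs := top_sum A T A1 d s hdle hTc htop x hxT (Finset.filter_subset _ _)
    obtain ⟨c, ρ, hc, hE, hρ⟩ := ih A2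
    have hdis : Disjoint A1 A2 := (Finset.disjoint_filter_filter_not _ _ _).symm
    have hA : A = A1 ∪ A2 := by
      rw [Finset.union_comm]; exact (Finset.filter_union_filter_not_eq _ _).symm
    have m2 : ∀ v ∈ A2, G.Adj x v := fun v hv => (Finset.mem_filter.mp hv).2
    have m1 : ∀ v ∈ A1, ¬ G.Adj x v := fun v hv => (Finset.mem_filter.mp hv).2
    set c' : V → ℕ := fun v => if G.Adj x v then c v + 1 else 0 with hc'
    have c1 : ∀ v ∈ A1, c' v = 0 := fun v hv => by simp [hc', m1 v hv]
    have c2 : ∀ v ∈ A2, c' v = c v + 1 := fun v hv => by simp [hc', m2 v hv]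
    refine ⟨c', ρ, ?_, ?_, ?_⟩
    · intro v hv
      by_cases hx : G.Adj x v
      · have := hc v (Finset.mem_filter.mpr ⟨hv, hx⟩)
        simp only [hc', hx, if_true]; omega
      · simp [hc', hx]
    · have split : ∀ (P : V → V → Prop) [∀ u v, Decidable (P u v)], (∀ u v, P u v → P v u) →
          pc A A P = pc A1 A1 P + 2 * pc A1 A2 P + pc A2 A2 P := by
        intro P _ hP
        rw [hA, pc_union_left _ _ _ hdis, pc_union_right _ _ _ hdis, pc_union_right _ _ _ hdis,
          pc_symm A2 A1 P hP]
        ring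
      rw [split _ (fun u v h => h.symm), split (fun u v => G.Adj u v ∧ c' u = c' v) (fun u v h => ⟨h.1.symm, h.2.symm⟩),
        split (fun u v => c' u ≠ c' v) (fun u v h => h.symm)]
      have a1 : pc A1 A1 (fun u v => G.Adj u v ∧ c' u = c' v) = pc A1 A1 (fun u v => G.Adj u v) := by
        apply pc_congr; intro u hu v hv; simp [c1 u hu, c1 v hv]
      have a2 : pc A1 A2 (fun u v => G.Adj u v ∧ c' u = c' v) = 0 := by
        apply pc_zero; intro u hu v hv; simp [c1 u hu, c2 v hv]
      have a3 : pc A2 A2 (fun u v => G.Adj u v ∧ c' u = c' v) = pc A2 A2 (fun u v => G.Adj u v ∧ c u = c v) := by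
        apply pc_congr; intro u hu v hv; simp [c2 u hu, c2 v hv]
      have b1 : pc A1 A2 (fun u v => c' u ≠ c' v) = A1.card * A2.card := by
        apply pc_full; intro u hu v hv; simp [c1 u hu, c2 v hv]
      have b2 : pc A2 A2 (fun u v => c' u ≠ c' v) = pc A2 A2 (fun u v => c u ≠ c v) := by
        apply pc_congr; intro u hu v hv; simp [c2 u hu, c2 v hv]
      have e : ∑ v ∈ A1, d v = pc A1 A1 (fun u v => G.Adj u v) + pc A1 A2 (fun u v => G.Adj u v) := by
        rw [← pc_union_right _ _ _ hdis, ← hA]; rfl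
      have e' : d x = A2.card := rfl
      rw [a1, a2, a3, b1, b2]
      rw [e, e'] at hs
      nlinarith
    · have : (s + 1) * clq G (k + 2) A2 ≤ clq G (k + 1 + 2) A := by
        calc (s + 1) * clq G (k + 2) A2 = ∑ t ∈ T, clq G (k + 2) A2 := by simp [hTc]
          _ ≤ ∑ t ∈ T, clq G (k + 2) (A.filter (fun y => G.Adj t y)) := Finset.sum_le_sum hmin
          _ ≤ ∑ t ∈ A, clq G (k + 2) (A.filter (fun y => G.Adj t y)) := Finset.sum_le_sum_of_subset hTA
          _ = _ := rfl
      calc ρ * (s + 1) ^ (k + 1 + 1) = (s + 1) * (ρ * (s + 1) ^ (k + 1)) := by ring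
        _ ≤ (s + 1) * (clq G (k + 2) A2 + s * (s + 1) ^ (k + 1)) := Nat.mul_le_mul_left _ hρ
        _ = (s + 1) * clq G (k + 2) A2 + s * (s + 1) ^ (k + 1 + 1) := by ring
        _ ≤ _ := by omega

/-- greedy embedding -/
theorem embed {V : Type*} [DecidableEq V] (G : SimpleGraph V) [DecidableRel G.Adj] {κ : Type*} [DecidableEq κ]
    (f : V → κ) (S : Finset V) (T m : ℝ) (hT : 0 ≤ T) (hm : 0 ≤ m)
    (hS : ∀ w ∈ S, ∀ j, j ≠ f w → ∀ A : Finset V, (((A.filter (fun v => f v = j)).filter (fun v => ¬ G.Adj w v)).card : ℝ) ≤ T)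
    (J : Finset κ) : ∀ A : Finset V,
    (∀ j ∈ J, m + ((J.card : ℝ) - 1) * T ≤ (((A.filter (fun v => f v = j)).filter (fun v => v ∈ S)).card : ℝ)) →
    m ^ J.card ≤ (clq G J.card A : ℝ) := by
  induction J using Finset.induction_on with
  | empty => intro A _; simp [clq]
  | insert j0 J hj ih =>
    intro A hA
    rw [Finset.card_insert_of_notMem hj] at hA ⊢
    set W := (A.filter (fun v => f v = j0)).filter (fun v => v ∈ S) with hW
    have hWA : W ⊆ A := (Finset.filter_subset _ _).trans (Finset.filter_subset _ _)
    have key : ∀ w ∈ W, m ^ J.card ≤ (clq G J.card (A.filter (fun y => G.Adj w y)) : ℝ) := by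
      intro w hw
      apply ih
      intro j hjJ
      simp only [hW, Finset.mem_filter] at hw
      have h1 := hA j (Finset.mem_insert_of_mem hjJ)
      have h2 := hS w hw.2 j (by rw [hw.1.2]; rintro rfl; exact hj hjJ) A
      have h3 : ((A.filter (fun v => f v = j)).filter (fun v => v ∈ S)).card ≤
          (((A.filter (fun y => G.Adj w y)).filter (fun v => f v = j)).filter (fun v => v ∈ S)).card +
          ((A.filter (fun v => f v = j)).filter (fun v => ¬ G.Adj w v)).card := by
        refine le_trans (Finset.card_le_card ?_) (Finset.card_union_le _ _)
        intro v hv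
        simp only [Finset.mem_filter, Finset.mem_union] at hv ⊢
        tauto
      have h3' : (((A.filter (fun v => f v = j)).filter (fun v => v ∈ S)).card : ℝ) ≤
          ((((A.filter (fun y => G.Adj w y)).filter (fun v => f v = j)).filter (fun v => v ∈ S)).card : ℝ) +
          (((A.filter (fun v => f v = j)).filter (fun v => ¬ G.Adj w v)).card : ℝ) := by exact_mod_cast h3
      push_cast at h1
      linarith
    have hWm : m ≤ (W.card : ℝ) := by
      have h1 := hA j0 (Finset.mem_insert_self _ _)
      push_cast at h1
      have : 0 ≤ (J.card : ℝ) * T := by positivity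
      linarith
    calc m ^ (J.card + 1) = m * m ^ J.card := by ring
      _ ≤ W.card * m ^ J.card := by gcongr
      _ = ∑ w ∈ W, m ^ J.card := by simp
      _ ≤ ∑ w ∈ W, (clq G J.card (A.filter (fun y => G.Adj w y)) : ℝ) := Finset.sum_le_sum key
      _ ≤ ∑ w ∈ A, (clq G J.card (A.filter (fun y => G.Adj w y)) : ℝ) :=
          Finset.sum_le_sum_of_subset_of_nonneg hWA (fun _ _ _ => by positivity)
      _ = _ := by simp [clq]

/-- number of ordered monochromatic edges -/
def mono {V : Type*} [Fintype V] (G : SimpleGraph V) [DecidableRel G.Adj] {n : ℕ} (f : V → Fin n) : ℕ :=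
  pc Finset.univ Finset.univ (fun u v => G.Adj u v ∧ f u = f v)

/-- class size -/
def csz {V : Type*} [Fintype V] {n : ℕ} (f : V → Fin n) (i : Fin n) : ℕ :=
  (Finset.univ.filter (fun v => f v = i)).card

/-- degree into class -/
def cdeg {V : Type*} [Fintype V] (G : SimpleGraph V) [DecidableRel G.Adj] {n : ℕ} (f : V → Fin n) (i : Fin n) (v : V) : ℕ :=
  (Finset.univ.filter (fun w => f w = i ∧ G.Adj v w)).card

/-- degree -/
def fdeg {V : Type*} [Fintype V] (G : SimpleGraph V) [DecidableRel G.Adj] (v : V) : ℕ :=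
  (Finset.univ.filter (fun w => G.Adj v w)).card

/-- ordered missing cross pairs -/
def miss {V : Type*} [Fintype V] (G : SimpleGraph V) [DecidableRel G.Adj] {n : ℕ} (f : V → Fin n) : ℕ :=
  pc Finset.univ Finset.univ (fun u v => f u ≠ f v ∧ ¬ G.Adj u v)

theorem min_switch {V : Type*} [DecidableEq V] [Fintype V] (G : SimpleGraph V) [DecidableRel G.Adj] {n : ℕ} (f : V → Fin n)
    (hmin : ∀ g : V → Fin n, mono G f ≤ mono G g) (v : V) (j : Fin n) :
    cdeg G f (f v) v ≤ cdeg G f j v := by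
  have key : ∀ g : V → Fin n, (∀ w, w ≠ v → g w = f w) → mono G g = 2 * cdeg G f (g v) v +
      pc (Finset.univ.erase v) (Finset.univ.erase v) (fun u w => G.Adj u w ∧ f u = f w) := by
    intro g hg
    have hA : (Finset.univ : Finset V) = {v} ∪ Finset.univ.erase v := by
      ext w; simp
    have hdis : Disjoint {v} ((Finset.univ : Finset V).erase v) := by simp
    have hs : mono G g = pc {v} {v} (fun u w => G.Adj u w ∧ g u = g w)
        + 2 * pc {v} (Finset.univ.erase v) (fun u w => G.Adj u w ∧ g u = g w)
        + pc (Finset.univ.erase v) (Finset.univ.erase v) (fun u w => G.Adj u w ∧ g u = g w) := by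
      unfold mono
      conv_lhs => rw [hA]
      rw [pc_union_left _ _ _ hdis, pc_union_right _ _ _ hdis, pc_union_right _ _ _ hdis,
          pc_symm (Finset.univ.erase v) {v} _ (fun u w h => ⟨h.1.symm, h.2.symm⟩)]
      ring
    rw [hs, pc_zero {v} {v} _ (by simp)]
    have h1 : pc {v} (Finset.univ.erase v) (fun u w => G.Adj u w ∧ g u = g w) = cdeg G f (g v) v := by
      simp only [pc, Finset.sum_singleton, cdeg]
      congr 1
      ext w
      simp only [Finset.mem_filter, Finset.mem_erase, Finset.mem_univ, and_true, true_and]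
      constructor
      · rintro ⟨h1, h2, h3⟩; rw [hg w h1] at h3; exact ⟨h3.symm, h2⟩
      · rintro ⟨h1, h2⟩
        have : w ≠ v := h2.ne'
        exact ⟨this, h2, by rw [hg w this, h1]⟩
    have h2 : pc (Finset.univ.erase v) (Finset.univ.erase v) (fun u w => G.Adj u w ∧ g u = g w)
        = pc (Finset.univ.erase v) (Finset.univ.erase v) (fun u w => G.Adj u w ∧ f u = f w) := by
      apply pc_congr
      intro u hu w hw
      rw [hg u (Finset.ne_of_mem_erase hu), hg w (Finset.ne_of_mem_erase hw)]
    rw [h1, h2]; ring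
  have h1 := key f (fun _ _ => rfl)
  have h2 := key (Function.update f v j) (fun w hw => Function.update_of_ne hw _ _)
  rw [Function.update_self] at h2
  have := hmin (Function.update f v j)
  omega

theorem sum_csz {V : Type*} [Fintype V] {n : ℕ} (f : V → Fin n) : ∑ i, csz f i = Fintype.card V := by
  unfold csz
  rw [← Finset.card_univ]
  exact (Finset.card_eq_sum_card_fiberwise (fun _ _ => Finset.mem_univ _)).symm

theorem pc_same {V : Type*} [Fintype V] {n : ℕ} (f : V → Fin n) :
    pc Finset.univ Finset.univ (fun u v => f u = f v) = ∑ i, (csz f i) ^ 2 := by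
  have : pc Finset.univ Finset.univ (fun u v => f u = f v) = ∑ u, csz f (f u) := by
    unfold pc csz
    apply Finset.sum_congr rfl
    intro u _
    congr 1
    ext v; simp [eq_comm]
  rw [this, ← Finset.sum_fiberwise' Finset.univ f (fun i => csz f i)]
  apply Finset.sum_congr rfl
  intro i _
  rw [Finset.sum_const, smul_eq_mul, sq]
  rfl

theorem sq_add_diff {V : Type*} [Fintype V] {n : ℕ} (f : V → Fin n) :
    ∑ i, (csz f i) ^ 2 + pc Finset.univ Finset.univ (fun u v => f u ≠ f v) = Fintype.card V ^ 2 := by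
  have h := pc_split (Finset.univ : Finset V) Finset.univ (fun _ _ => True) (fun u v => f u = f v)
  rw [pc_full _ _ _ (by simp)] at h
  rw [← pc_same, sq, ← Finset.card_univ, h]
  congr 1
  · exact pc_congr _ _ _ _ (by simp)
  · exact pc_congr _ _ _ _ (by simp)

theorem count_id {V : Type*} [Fintype V] (G : SimpleGraph V) [DecidableRel G.Adj] {n : ℕ} (f : V → Fin n) :
    ∑ i, (csz f i) ^ 2 + ∑ v, fdeg G v + miss G f = Fintype.card V ^ 2 + mono G f := by
  have h1 := pc_split (Finset.univ : Finset V) Finset.univ (fun u v => G.Adj u v) (fun u v => f u = f v)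
  have h2 := pc_split (Finset.univ : Finset V) Finset.univ (fun u v => f u ≠ f v) (fun u v => G.Adj u v)
  have h3 := sq_add_diff f
  have e1 : pc (Finset.univ : Finset V) Finset.univ (fun u v => G.Adj u v) = ∑ v, fdeg G v := rfl
  have e2 : pc (Finset.univ : Finset V) Finset.univ (fun u v => G.Adj u v ∧ ¬ f u = f v) =
    pc (Finset.univ : Finset V) Finset.univ (fun u v => f u ≠ f v ∧ G.Adj u v) :=
    pc_congr _ _ _ _ (fun u _ v _ => and_comm)
  unfold miss mono
  omega

theorem dev_id {V : Type*} [Fintype V] {p : ℕ} (hp : 2 ≤ p) (f : V → Fin (p - 1)) :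
    ∑ i, ((csz f i : ℝ) - Fintype.card V / ((p : ℝ) - 1)) ^ 2
      = ∑ i, (csz f i : ℝ) ^ 2 - (Fintype.card V : ℝ) ^ 2 / ((p : ℝ) - 1) := by
  have hP : (2 : ℝ) ≤ p := by exact_mod_cast hp
  have hne : (p : ℝ) - 1 ≠ 0 := by linarith
  have hs : ∑ i, (csz f i : ℝ) = Fintype.card V := by exact_mod_cast sum_csz f
  simp only [sub_sq]
  rw [Finset.sum_add_distrib, Finset.sum_sub_distrib, ← Finset.sum_mul, ← Finset.mul_sum, hs]
  simp only [Finset.sum_const, Finset.card_univ, Fintype.card_fin, nsmul_eq_mul]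
  rw [Nat.cast_sub (by omega)]
  push_cast
  field_simp
  ring

/-- main structural inequality -/
theorem struct_ineq {V : Type*} [Fintype V] (G : SimpleGraph V) [DecidableRel G.Adj] {p : ℕ} (hp : 2 ≤ p) (f : V → Fin (p - 1))
    (γ : ℝ) (hdeg : ∀ v, (1 - 1 / ((p : ℝ) - 1) - γ) * Fintype.card V ≤ (fdeg G v : ℝ)) :
    ∑ i, ((csz f i : ℝ) - Fintype.card V / ((p : ℝ) - 1)) ^ 2 + miss G f
      ≤ γ * (Fintype.card V : ℝ) ^ 2 + mono G f := by
  rw [dev_id hp]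
  have h1 : ∑ i, (csz f i : ℝ) ^ 2 + ∑ v, (fdeg G v : ℝ) + miss G f = (Fintype.card V : ℝ) ^ 2 + mono G f := by
    exact_mod_cast count_id G f
  have h2 : (1 - 1 / ((p : ℝ) - 1) - γ) * (Fintype.card V : ℝ) ^ 2 ≤ ∑ v, (fdeg G v : ℝ) := by
    calc _ = ∑ v : V, (1 - 1 / ((p : ℝ) - 1) - γ) * Fintype.card V := by simp; ring
      _ ≤ _ := Finset.sum_le_sum (fun v _ => hdeg v)
  have : (Fintype.card V : ℝ) ^ 2 / ((p : ℝ) - 1) = 1 / ((p : ℝ) - 1) * (Fintype.card V : ℝ) ^ 2 := by ring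
  rw [this]
  linarith

theorem num1 (p : ℕ) (hp : 3 ≤ p) : 4 ^ p * p.factorial ≤ p ^ (2 * p + 1) := by
  have h1 : p.factorial ≤ p ^ p := Nat.factorial_le_pow p
  have h2 : 4 ^ p ≤ p ^ (p + 1) := by
    rcases Nat.eq_or_lt_of_le hp with h | h
    · rw [← h]; norm_num
    · calc 4 ^ p ≤ p ^ p := Nat.pow_le_pow_left h _
        _ ≤ p ^ (p + 1) := Nat.pow_le_pow_right (by omega) (by omega)
  calc _ ≤ p ^ (p + 1) * p ^ p := Nat.mul_le_mul h2 h1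
    _ = _ := by rw [← pow_add]; congr 1; ring

theorem rough {V : Type*} [DecidableEq V] [Fintype V] (G : SimpleGraph V) [DecidableRel G.Adj] {p : ℕ} (hp : 3 ≤ p)
    (ε : ℝ) (hN : 0 < Fintype.card V) (hε : ((p : ℝ) ^ 6)⁻¹ ≤ ε)
    (hdeg : ∀ v, (1 - 1 / ((p : ℝ) - 1) - ε / 2) * Fintype.card V ≤ (fdeg G v : ℝ))
    (hK : (clq G p Finset.univ : ℝ) ≤ p.factorial * (((p : ℝ) ^ (10 * p))⁻¹ * ε * (Fintype.card V : ℝ) ^ p)) :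
    ∃ f : V → Fin (p - 1), (mono G f : ℝ) ≤ (1 / 2 + 1 / (p : ℝ)) * ε * (Fintype.card V : ℝ) ^ 2 := by
  have hP : (3 : ℝ) ≤ p := by exact_mod_cast hp
  have hP0 : (0 : ℝ) < p := by linarith
  have hε0 : 0 < ε := lt_of_lt_of_le (by positivity) hε
  set N : ℝ := (Fintype.card V : ℝ) with hNdef
  have hN0 : 0 < N := by rw [hNdef]; exact_mod_cast hN
  set δ : ℝ := ε / (4 * (p : ℝ) ^ 2) with hδ
  have hδ0 : 0 < δ := by positivity
  obtain ⟨s, hs⟩ : ∃ s, ⌈δ * N⌉₊ = s + 1 :=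
    Nat.exists_eq_succ_of_ne_zero (Nat.ceil_pos.mpr (by positivity)).ne'
  have hs1 : (s : ℝ) ≤ δ * N := by
    have := Nat.ceil_lt_add_one (a := δ * N) (by positivity)
    rw [hs] at this; push_cast at this; linarith
  have hs2 : δ * N ≤ (s : ℝ) + 1 := by
    have := Nat.le_ceil (δ * N)
    rw [hs] at this; push_cast at this; linarith
  obtain ⟨c, ρ, hc, hE, hρ⟩ := furedi G s (p - 2) Finset.univ
  have e1 : p - 2 + 1 = p - 1 := by omega
  have e2 : p - 2 + 2 = p := by omega
  rw [e1] at hE hc hρ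
  rw [e2] at hρ
  have hρ' : (ρ : ℝ) * ((s : ℝ) + 1) ^ (p - 1) ≤ clq G p Finset.univ + s * ((s : ℝ) + 1) ^ (p - 1) := by
    exact_mod_cast hρ
  refine ⟨fun v => ⟨c v, hc v (Finset.mem_univ v)⟩, ?_⟩
  set f : V → Fin (p - 1) := fun v => ⟨c v, hc v (Finset.mem_univ v)⟩ with hf
  have hm : mono G f = pc Finset.univ Finset.univ (fun u v => G.Adj u v ∧ c u = c v) := by
    apply pc_congr; intro u _ v _; simp [hf]
  have hd : pc Finset.univ Finset.univ (fun u v => f u ≠ f v) = pc Finset.univ Finset.univ (fun u v => c u ≠ c v) := by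
    apply pc_congr; intro u _ v _; simp [hf]
  rw [← hm, ← hd] at hE
  have hsq := sq_add_diff f
  have hE' : ∑ v, (fdeg G v : ℝ) + mono G f ≤ pc Finset.univ Finset.univ (fun u v => f u ≠ f v)
      + 2 * ((p : ℝ) - 1) * s * N + 2 * ρ * N := by
    have : ((∑ v, fdeg G v + mono G f : ℕ) : ℝ) ≤ ((pc Finset.univ Finset.univ (fun u v => f u ≠ f v) + 2 * (p - 1) * s * Fintype.card V + 2 * ρ * Fintype.card V : ℕ) : ℝ) := Nat.cast_le.mpr hE
    push_cast [Nat.cast_sub (show 1 ≤ p by omega)] at this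
    exact this
  have hsq' : ∑ i, (csz f i : ℝ) ^ 2 + pc Finset.univ Finset.univ (fun u v => f u ≠ f v) = N ^ 2 := by
    rw [hNdef]; exact_mod_cast hsq
  have hdev := dev_id (by omega : 2 ≤ p) f
  have hdev0 : 0 ≤ ∑ i, ((csz f i : ℝ) - Fintype.card V / ((p : ℝ) - 1)) ^ 2 := Finset.sum_nonneg (fun _ _ => sq_nonneg _)
  have h2 : (1 - 1 / ((p : ℝ) - 1) - ε / 2) * N ^ 2 ≤ ∑ v, (fdeg G v : ℝ) := by
    calc _ = ∑ v : V, (1 - 1 / ((p : ℝ) - 1) - ε / 2) * N := by simp [← hNdef]; ring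
      _ ≤ _ := Finset.sum_le_sum (fun v _ => hdeg v)
  have e3 : N ^ 2 / ((p : ℝ) - 1) = 1 / ((p : ℝ) - 1) * N ^ 2 := by ring
  rw [e3] at hdev
  -- the bound on ρ
  have num : (p.factorial : ℝ) * ((p : ℝ) ^ (10 * p))⁻¹ ≤ δ ^ (p - 1) * (1 / (4 * p)) := by
    have hδ1 : ((4 : ℝ) * (p : ℝ) ^ 8)⁻¹ ≤ δ := by
      have : ((4 : ℝ) * (p : ℝ) ^ 8)⁻¹ = ((p : ℝ) ^ 6)⁻¹ / (4 * (p : ℝ) ^ 2) := by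
        field_simp
      rw [this, hδ]
      gcongr
    have n1 : ((4 : ℝ) ^ p * p.factorial) ≤ (p : ℝ) ^ (2 * p + 1) := by exact_mod_cast num1 p hp
    calc (p.factorial : ℝ) * ((p : ℝ) ^ (10 * p))⁻¹
        ≤ (((4 : ℝ) * (p : ℝ) ^ 8)⁻¹) ^ (p - 1) * (1 / (4 * p)) := by
          obtain ⟨q, rfl⟩ : ∃ q, p = q + 1 := ⟨p - 1, by omega⟩
          simp only [Nat.add_sub_cancel]
          set P : ℝ := ((q + 1 : ℕ) : ℝ)
          rw [inv_pow, ← one_div, ← one_div, ← div_eq_mul_one_div, div_mul_div_comm, div_le_div_iff₀ (by positivity) (by positivity)]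
          have hP1 : 1 ≤ P := by linarith
          calc ((q + 1).factorial : ℝ) * ((4 * P ^ 8) ^ q * (4 * P)) = (4 ^ (q + 1) * (q + 1).factorial) * P ^ (8 * q + 1) := by
                rw [mul_pow]; ring
            _ ≤ P ^ (2 * (q + 1) + 1) * P ^ (8 * q + 1) := by gcongr
            _ = P ^ (10 * q + 4) := by rw [← pow_add]; congr 1; ring
            _ ≤ P ^ (10 * (q + 1)) := pow_le_pow_right₀ hP1 (by omega)
            _ = 1 * 1 * P ^ (10 * (q + 1)) := by ring
      _ ≤ _ := by gcongr
  have hρN : (ρ : ℝ) ≤ s + ε / (4 * p) * N := by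
    have hpos : 0 < ((s : ℝ) + 1) ^ (p - 1) := by positivity
    have hk : (clq G p Finset.univ : ℝ) ≤ (ε / (4 * p) * N) * ((s : ℝ) + 1) ^ (p - 1) := by
      calc (clq G p Finset.univ : ℝ) ≤ _ := hK
        _ = (p.factorial * ((p : ℝ) ^ (10 * p))⁻¹) * (ε * N ^ p) := by ring
        _ ≤ (δ ^ (p - 1) * (1 / (4 * p))) * (ε * N ^ p) := by gcongr
        _ = (ε / (4 * p) * N) * (δ * N) ^ (p - 1) := by
          obtain ⟨q, rfl⟩ : ∃ q, p = q + 1 := ⟨p - 1, by omega⟩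
          simp only [Nat.add_sub_cancel]
          rw [mul_pow, pow_succ]; ring
        _ ≤ _ := by gcongr
    have : (ρ : ℝ) * ((s : ℝ) + 1) ^ (p - 1) ≤ (s + ε / (4 * p) * N) * ((s : ℝ) + 1) ^ (p - 1) := by
      rw [add_mul]; linarith
    exact le_of_mul_le_mul_right this hpos
  have f1 : 2 * ((p : ℝ) - 1) * s * N ≤ 2 * ((p : ℝ) - 1) * (δ * N) * N := by
    have : 0 ≤ (p : ℝ) - 1 := by linarith
    gcongr
  have f2 : 2 * (ρ : ℝ) * N ≤ 2 * (δ * N + ε / (4 * p) * N) * N := by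
    gcongr; linarith
  have f3 : 2 * ((p : ℝ) - 1) * (δ * N) * N + 2 * (δ * N + ε / (4 * p) * N) * N = 1 / (p : ℝ) * ε * N ^ 2 := by
    rw [hδ]; field_simp; ring
  have : (mono G f : ℝ) ≤ ε / 2 * N ^ 2 + 1 / (p : ℝ) * ε * N ^ 2 := by linarith
  linarith

theorem nonnbr {V : Type*} [DecidableEq V] [Fintype V] (G : SimpleGraph V) [DecidableRel G.Adj] {n : ℕ} (f : V → Fin n)
    (w : V) (j : Fin n) (hj : j ≠ f w) (A : Finset V) :
    ((A.filter (fun v => f v = j)).filter (fun v => ¬ G.Adj w v)).card + csz f (f w) + fdeg G w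
      ≤ Fintype.card V + cdeg G f (f w) w := by
  have h1 : ((A.filter (fun v => f v = j)).filter (fun v => ¬ G.Adj w v)).card
      + ((Finset.univ.filter (fun v => f v = f w)).filter (fun v => ¬ G.Adj w v)).card
      ≤ (Finset.univ.filter (fun v => ¬ G.Adj w v)).card := by
    rw [← Finset.card_union_of_disjoint]
    · apply Finset.card_le_card
      intro v hv
      simp only [Finset.mem_union, Finset.mem_filter, Finset.mem_univ, true_and] at hv ⊢
      tauto
    · rw [Finset.disjoint_left]
      intro v hv hv'
      simp only [Finset.mem_filter, Finset.mem_univ, true_and] at hv hv'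
      exact hj (hv.1.2.symm.trans hv'.1)
  have h2 := Finset.card_filter_add_card_filter_not (s := (Finset.univ : Finset V)) (fun v => G.Adj w v)
  have h3 := Finset.card_filter_add_card_filter_not (s := Finset.univ.filter (fun v => f v = f w)) (fun v => G.Adj w v)
  rw [Finset.filter_filter] at h3
  rw [Finset.card_univ] at h2
  unfold csz fdeg cdeg
  omega

theorem mono_eq {V : Type*} [Fintype V] (G : SimpleGraph V) [DecidableRel G.Adj] {n : ℕ} (f : V → Fin n) :
    mono G f = ∑ v, cdeg G f (f v) v := by
  unfold mono pc cdeg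
  apply Finset.sum_congr rfl
  intro v _
  congr 1
  ext w
  simp only [Finset.mem_filter, Finset.mem_univ, true_and]
  rw [and_comm, eq_comm]

set_option maxHeartbeats 1600000 in
theorem boot {V : Type*} [DecidableEq V] [Fintype V] (G : SimpleGraph V) [DecidableRel G.Adj] {p : ℕ} (hp : 3 ≤ p)
    (ε : ℝ) (hN : 0 < Fintype.card V) (hε0 : 0 < ε) (hε : ε ≤ ((p : ℝ) ^ 6)⁻¹)
    (hdeg : ∀ v, (1 - 1 / ((p : ℝ) - 1) - ε / 2) * Fintype.card V ≤ (fdeg G v : ℝ))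
    (hK : (clq G p Finset.univ : ℝ) ≤ p.factorial * (((p : ℝ) ^ (10 * p))⁻¹ * ε * (Fintype.card V : ℝ) ^ p))
    (f : V → Fin (p - 1))
    (hI : (mono G f : ℝ) ≤ (1 / 2 + 1 / (p : ℝ)) * ((p : ℝ) ^ 6)⁻¹ * (Fintype.card V : ℝ) ^ 2)
    (hiv : ∀ v j, cdeg G f (f v) v ≤ cdeg G f j v) :
    (mono G f : ℝ) ≤ ε / 2 * (Fintype.card V : ℝ) ^ 2 := by
  have hst := struct_ineq G (by omega : 2 ≤ p) f _ hdeg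
  have hnn := nonnbr G f
  have hP : (3 : ℝ) ≤ p := by exact_mod_cast hp
  have hP0 : (0 : ℝ) < p := by linarith
  have hN0 : (0 : ℝ) < (Fintype.card V : ℝ) := by exact_mod_cast hN
  have hnn' : ∀ (w : V) (j : Fin (p - 1)), j ≠ f w → ∀ A : Finset V,
      (((A.filter (fun v => f v = j)).filter (fun v => ¬ G.Adj w v)).card : ℝ) + csz f (f w) + fdeg G w
      ≤ (Fintype.card V : ℝ) + cdeg G f (f w) w := by
    intro w j hj A
    exact_mod_cast hnn w j hj A
  set N : ℝ := (Fintype.card V : ℝ) with hNdef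
  set P : ℝ := (p : ℝ) with hPdef
  set z : ℝ := (P ^ 3)⁻¹ with hz
  have hz0 : 0 < z := by positivity
  have hz2 : (P ^ 6)⁻¹ = z ^ 2 := by rw [hz, inv_pow, ← pow_mul]
  rw [hz2] at hε hI
  have hz27 : z ≤ 1 / 27 := by
    rw [hz, inv_eq_one_div]
    apply one_div_le_one_div_of_le (by norm_num)
    calc (27 : ℝ) = 3 ^ 3 := by norm_num
      _ ≤ P ^ 3 := by gcongr
  have hzP : z * P ^ 3 = 1 := by rw [hz]; field_simp
  have hεz : ε / 2 ≤ z / 54 := by nlinarith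
  have hPinv : 1 / P ≤ 1 / 3 := one_div_le_one_div_of_le (by norm_num) hP
  have hI' : (mono G f : ℝ) ≤ 5 / 6 * z ^ 2 * N ^ 2 := by
    refine hI.trans ?_
    have : 1 / 2 + 1 / P ≤ 5 / 6 := by linarith
    gcongr
  have hsz : ∀ i, N / (P - 1) - 1.16 * z * N ≤ csz f i := by
    intro i
    have h1 : ((csz f i : ℝ) - N / (P - 1)) ^ 2 ≤ ∑ i, ((csz f i : ℝ) - N / (P - 1)) ^ 2 :=
      Finset.single_le_sum (f := fun i => ((csz f i : ℝ) - N / (P - 1)) ^ 2) (fun _ _ => sq_nonneg _) (Finset.mem_univ i)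
    have h2 : ((csz f i : ℝ) - N / (P - 1)) ^ 2 ≤ (1.16 * z * N) ^ 2 := by
      have h3 : (0 : ℝ) ≤ miss G f := Nat.cast_nonneg _
      have h4 : ε / 2 * N ^ 2 ≤ z ^ 2 / 2 * N ^ 2 := by gcongr
      have h5 : 0 ≤ z ^ 2 * N ^ 2 := by positivity
      nlinarith
    have := abs_le_of_sq_le_sq h2 (by positivity)
    linarith [(abs_le.mp this).1]
  have hmono : (mono G f : ℝ) = ∑ v, (cdeg G f (f v) v : ℝ) := by exact_mod_cast mono_eq G f
  set H' : Finset V := Finset.univ.filter (fun v => z * N ≤ (cdeg G f (f v) v : ℝ)) with hH'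
  have hH'c : (H'.card : ℝ) ≤ 5 / 6 * z * N := by
    have : (H'.card : ℝ) * (z * N) ≤ 5 / 6 * z * N * (z * N) := by
      calc (H'.card : ℝ) * (z * N) = ∑ v ∈ H', z * N := by simp
        _ ≤ ∑ v ∈ H', (cdeg G f (f v) v : ℝ) := Finset.sum_le_sum (fun v hv => (Finset.mem_filter.mp hv).2)
        _ ≤ ∑ v, (cdeg G f (f v) v : ℝ) := Finset.sum_le_sum_of_subset_of_nonneg (Finset.subset_univ _) (fun _ _ _ => by positivity)
        _ ≤ 5 / 6 * z ^ 2 * N ^ 2 := by rw [← hmono]; exact hI'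
        _ = _ := by ring
    exact le_of_mul_le_mul_right this (by positivity)
  set S : Finset V := Finset.univ.filter (fun v => v ∉ H') with hS
  have hq : N / (P - 1) = 1 / (P - 1) * N := by ring
  have hεN : ε / 2 * N ≤ z / 54 * N := by gcongr
  have hzN : 0 < z * N := by positivity
  -- nonneighbours outside own class
  have hout : ∀ (b : ℝ) (w : V), (cdeg G f (f w) w : ℝ) ≤ b → ∀ j, j ≠ f w → ∀ A : Finset V,
      (((A.filter (fun v => f v = j)).filter (fun v => ¬ G.Adj w v)).card : ℝ) ≤ b + 1.2 * z * N := by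
    intro b w hb j hj A
    have h1 := hnn' w j hj A
    have h2 := hdeg w
    have h3 := hsz (f w)
    rw [hq] at h3
    linarith
  have hST : ∀ w ∈ S, ∀ j, j ≠ f w → ∀ A : Finset V,
      (((A.filter (fun v => f v = j)).filter (fun v => ¬ G.Adj w v)).card : ℝ) ≤ 2.2 * z * N := by
    intro w hw j hj A
    have hw' : (cdeg G f (f w) w : ℝ) ≤ z * N := by
      simp only [hS, hH', Finset.mem_filter, Finset.mem_univ, true_and, not_le] at hw
      exact hw.le
    have := hout _ w hw' j hj A
    linarith
  set β : ℝ := (2.2 * (P - 1) - 1) * z with hβ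
  set m : ℝ := N / P ^ 4 with hm
  have hm0 : 0 < m := by positivity
  have hmz : m ≤ z * N / 3 := by
    have : m = z * N * (1 / P) := by rw [hm, hz]; field_simp
    rw [this]
    calc z * N * (1 / P) ≤ z * N * (1 / 3) := by gcongr
      _ = _ := by ring
  set H : Finset V := Finset.univ.filter (fun v => β * N ≤ (cdeg G f (f v) v : ℝ)) with hH
  set Hc : Finset V := Finset.univ.filter (fun v => ¬ β * N ≤ (cdeg G f (f v) v : ℝ)) with hHc
  have hp1 : ((p - 1 : ℕ) : ℝ) = P - 1 := by rw [Nat.cast_sub (by omega)]; simp [hPdef]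
  have hp2 : ((p - 1 - 1 : ℕ) : ℝ) = P - 2 := by
    rw [Nat.sub_sub, Nat.cast_sub (by omega)]; simp [hPdef]
  -- (B)
  have hB : ∀ u ∈ H, m ^ (p - 1) ≤ (clq G (p - 1) (Finset.univ.filter (fun y => G.Adj u y)) : ℝ) := by
    intro u hu
    have := embed G f S (2.2 * z * N) m (by positivity) hm0.le hST Finset.univ
      (Finset.univ.filter (fun y => G.Adj u y)) ?_
    · simpa using this
    intro j _
    rw [Finset.card_univ, Fintype.card_fin, hp1]
    have h1 : cdeg G f j u ≤ (((Finset.univ.filter (fun y => G.Adj u y)).filter (fun v => f v = j)).filter (fun v => v ∈ S)).card + H'.card := by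
      refine le_trans (Finset.card_le_card ?_) (Finset.card_union_le _ _)
      intro v hv
      simp only [hS, Finset.mem_filter, Finset.mem_union, Finset.mem_univ, true_and] at hv ⊢
      tauto
    have h1' : (cdeg G f j u : ℝ) ≤ (((Finset.univ.filter (fun y => G.Adj u y)).filter (fun v => f v = j)).filter (fun v => v ∈ S)).card + (H'.card : ℝ) := by
      exact_mod_cast h1
    have h2 : (cdeg G f (f u) u : ℝ) ≤ cdeg G f j u := by exact_mod_cast hiv u j
    have h3 : β * N ≤ (cdeg G f (f u) u : ℝ) := (Finset.mem_filter.mp hu).2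
    have h4 : β * N = 2.2 * (P - 1) * (z * N) - z * N := by rw [hβ]; ring
    have h5 : (P - 1 - 1) * (2.2 * z * N) = 2.2 * (P - 1) * (z * N) - 2.2 * (z * N) := by ring
    linarith
  -- (A)
  have hq2 : (6.6 * (P - 1) - 1) * z ≤ 1 / (P - 1) := by
    rw [le_div_iff₀ (by linarith)]
    have h0 : (6.6 * (P - 1) - 1) * (P - 1) ≤ P ^ 3 := by
      obtain ⟨t, ht⟩ : ∃ t, P = t + 3 := ⟨P - 3, by ring⟩
      have ht0 : 0 ≤ t := by linarith
      rw [ht]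
      have : 0 ≤ t ^ 3 := by positivity
      have : 0 ≤ t ^ 2 := by positivity
      ring_nf
      linarith
    calc (6.6 * (P - 1) - 1) * z * (P - 1) = z * ((6.6 * (P - 1) - 1) * (P - 1)) := by ring
      _ ≤ z * P ^ 3 := by gcongr
      _ = 1 := hzP
  have hA : ∀ u ∈ Hc, ∀ v ∈ Hc, f u = f v →
      m ^ (p - 2) ≤ (clq G (p - 2) ((Finset.univ.filter (fun y => G.Adj u y)).filter (fun y => G.Adj v y)) : ℝ) := by
    intro u hu v hv huv
    have := embed G f S (2.2 * z * N) m (by positivity) hm0.le hST (Finset.univ.erase (f u))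
      ((Finset.univ.filter (fun y => G.Adj u y)).filter (fun y => G.Adj v y)) ?_
    · rw [Finset.card_erase_of_mem (Finset.mem_univ _), Finset.card_univ, Fintype.card_fin, Nat.sub_sub] at this
      exact this
    intro j hj
    have hj : j ≠ f u := Finset.ne_of_mem_erase hj
    rw [Finset.card_erase_of_mem (Finset.mem_univ _), Finset.card_univ, Fintype.card_fin, hp2]
    have h1 : csz f j ≤ ((((Finset.univ.filter (fun y => G.Adj u y)).filter (fun y => G.Adj v y)).filter (fun v => f v = j)).filter (fun v => v ∈ S)).card + H'.card
       + ((Finset.univ.filter (fun v => f v = j)).filter (fun y => ¬ G.Adj u y)).card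
       + ((Finset.univ.filter (fun v => f v = j)).filter (fun y => ¬ G.Adj v y)).card := by
      refine le_trans (Finset.card_le_card ?_) ((Finset.card_union_le _ _).trans (Nat.add_le_add_right ((Finset.card_union_le _ _).trans (Nat.add_le_add_right (Finset.card_union_le _ _) _)) _))
      intro w hw
      simp only [hS, Finset.mem_filter, Finset.mem_union, Finset.mem_univ, true_and] at hw ⊢
      tauto
    have h1' : (csz f j : ℝ) ≤ ((((Finset.univ.filter (fun y => G.Adj u y)).filter (fun y => G.Adj v y)).filter (fun v => f v = j)).filter (fun v => v ∈ S)).card + (H'.card : ℝ)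
       + ((Finset.univ.filter (fun v => f v = j)).filter (fun y => ¬ G.Adj u y)).card
       + ((Finset.univ.filter (fun v => f v = j)).filter (fun y => ¬ G.Adj v y)).card := by
      exact_mod_cast h1
    have hu' := hout (β * N) u (not_le.mp (Finset.mem_filter.mp hu).2).le j hj Finset.univ
    have hv' := hout (β * N) v (not_le.mp (Finset.mem_filter.mp hv).2).le j (huv ▸ hj) Finset.univ
    have h3 := hsz j
    rw [hq] at h3
    have h4 : β * N = 2.2 * (P - 1) * (z * N) - z * N := by rw [hβ]; ring
    have h5 : (P - 2 - 1) * (2.2 * z * N) = 2.2 * (P - 1) * (z * N) - 4.4 * (z * N) := by ring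
    have h6 : 6.6 * (P - 1) * (z * N) - z * N ≤ 1 / (P - 1) * N := by
      calc _ = ((6.6 * (P - 1) - 1) * z) * N := by ring
        _ ≤ _ := by gcongr
    linarith
  -- clique counts
  have hKm : (clq G p Finset.univ : ℝ) ≤ ε / 12 * N * m ^ (p - 1) := by
    refine hK.trans ?_
    have hf : (p.factorial : ℝ) ≤ P ^ p := by rw [hPdef]; exact_mod_cast Nat.factorial_le_pow p
    have key : (p.factorial : ℝ) * (P ^ (10 * p))⁻¹ ≤ 1 / 12 * (1 / P ^ 4) ^ (p - 1) := by
      rw [one_div_pow, one_div_mul_one_div, ← one_div, ← div_eq_mul_one_div, div_le_div_iff₀ (by positivity) (by positivity)]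
      have h12 : (12 : ℝ) ≤ P ^ 3 := by
        calc (12 : ℝ) ≤ 3 ^ 3 := by norm_num
          _ ≤ P ^ 3 := by gcongr
      calc (p.factorial : ℝ) * (12 * (P ^ 4) ^ (p - 1)) ≤ P ^ p * (P ^ 3 * (P ^ 4) ^ (p - 1)) := by gcongr
        _ = P ^ (p + 3 + 4 * (p - 1)) := by rw [← pow_mul, ← pow_add, ← pow_add]; congr 1; ring
        _ ≤ P ^ (10 * p) := pow_le_pow_right₀ (by linarith) (by omega)
        _ = _ := by ring
    calc _ = ((p.factorial : ℝ) * (P ^ (10 * p))⁻¹) * (ε * N ^ p) := by ring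
      _ ≤ (1 / 12 * (1 / P ^ 4) ^ (p - 1)) * (ε * N ^ p) := by gcongr
      _ = (1 / 12 * (1 / P ^ 4) ^ (p - 1)) * (ε * (N ^ (p - 1) * N)) := by
        rw [← pow_succ]; congr 4; omega
      _ = _ := by rw [hm, div_eq_mul_one_div N, mul_pow]; ring
  have hHcard : (H.card : ℝ) ≤ ε / 12 * N := by
    have : (H.card : ℝ) * m ^ (p - 1) ≤ ε / 12 * N * m ^ (p - 1) := by
      calc (H.card : ℝ) * m ^ (p - 1) = ∑ u ∈ H, m ^ (p - 1) := by simp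
        _ ≤ ∑ u ∈ H, (clq G (p - 1) (Finset.univ.filter (fun y => G.Adj u y)) : ℝ) := Finset.sum_le_sum hB
        _ ≤ ∑ u, (clq G (p - 1) (Finset.univ.filter (fun y => G.Adj u y)) : ℝ) :=
          Finset.sum_le_sum_of_subset_of_nonneg (Finset.subset_univ _) (fun _ _ _ => by positivity)
        _ = (clq G (p - 1 + 1) Finset.univ : ℝ) := by simp [clq]
        _ = (clq G p Finset.univ : ℝ) := by rw [Nat.sub_add_cancel (by omega)]
        _ ≤ _ := hKm
    exact le_of_mul_le_mul_right this (by positivity)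
  have hJ : (pc Hc Hc (fun u v => G.Adj u v ∧ f u = f v) : ℝ) ≤ ε / 12 * N * m := by
    have : (pc Hc Hc (fun u v => G.Adj u v ∧ f u = f v) : ℝ) * m ^ (p - 2) ≤ ε / 12 * N * m * m ^ (p - 2) := by
      calc (pc Hc Hc (fun u v => G.Adj u v ∧ f u = f v) : ℝ) * m ^ (p - 2)
          = ∑ u ∈ Hc, ∑ v ∈ Hc.filter (fun v => G.Adj u v ∧ f u = f v), m ^ (p - 2) := by
            simp [pc, Finset.sum_mul]
        _ ≤ ∑ u ∈ Hc, ∑ v ∈ Hc.filter (fun v => G.Adj u v ∧ f u = f v),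
              (clq G (p - 2) ((Finset.univ.filter (fun y => G.Adj u y)).filter (fun y => G.Adj v y)) : ℝ) := by
            apply Finset.sum_le_sum
            intro u hu
            apply Finset.sum_le_sum
            intro v hv
            rw [Finset.mem_filter] at hv
            exact hA u hu v hv.1 hv.2.2
        _ ≤ ∑ u ∈ Hc, ∑ v ∈ Finset.univ.filter (fun y => G.Adj u y),
              (clq G (p - 2) ((Finset.univ.filter (fun y => G.Adj u y)).filter (fun y => G.Adj v y)) : ℝ) := by
            apply Finset.sum_le_sum
            intro u hu
            apply Finset.sum_le_sum_of_subset_of_nonneg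
            · intro v hv
              simp only [Finset.mem_filter, Finset.mem_univ, true_and] at hv ⊢
              exact hv.2.1
            · intros; positivity
        _ ≤ ∑ u, ∑ v ∈ Finset.univ.filter (fun y => G.Adj u y),
              (clq G (p - 2) ((Finset.univ.filter (fun y => G.Adj u y)).filter (fun y => G.Adj v y)) : ℝ) :=
            Finset.sum_le_sum_of_subset_of_nonneg (Finset.subset_univ _) (fun _ _ _ => by positivity)
        _ = (clq G (p - 2 + 2) Finset.univ : ℝ) := by simp [clq]
        _ = (clq G p Finset.univ : ℝ) := by rw [Nat.sub_add_cancel (by omega)]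
        _ ≤ _ := hKm
        _ = ε / 12 * N * m * m ^ (p - 2) := by
          rw [mul_assoc _ m, ← pow_succ']; congr 2; omega
    exact le_of_mul_le_mul_right this (by positivity)
  have hsplit : mono G f ≤ pc Hc Hc (fun u v => G.Adj u v ∧ f u = f v) + 2 * (H.card * Fintype.card V) := by
    have hdis : Disjoint H Hc := Finset.disjoint_filter_filter_not _ _ _
    have hU : (Finset.univ : Finset V) = H ∪ Hc := (Finset.filter_union_filter_not_eq _ _).symm
    have e1 : mono G f = pc H Finset.univ (fun u v => G.Adj u v ∧ f u = f v) + pc Hc Finset.univ (fun u v => G.Adj u v ∧ f u = f v) := by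
      rw [← pc_union_left _ _ _ hdis, ← hU]; rfl
    have e2 : pc Hc Finset.univ (fun u v => G.Adj u v ∧ f u = f v) = pc Hc H (fun u v => G.Adj u v ∧ f u = f v) + pc Hc Hc (fun u v => G.Adj u v ∧ f u = f v) := by
      rw [← pc_union_right _ _ _ hdis, ← hU]
    have e3 := pc_le H Finset.univ (fun u v => G.Adj u v ∧ f u = f v)
    have e4 := pc_le Hc H (fun u v => G.Adj u v ∧ f u = f v)
    have e5 : Hc.card * H.card ≤ H.card * Fintype.card V := by
      rw [mul_comm]; exact Nat.mul_le_mul_left _ (Finset.card_le_univ _)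
    rw [Finset.card_univ] at e3
    omega
  have hsplit' : (mono G f : ℝ) ≤ pc Hc Hc (fun u v => G.Adj u v ∧ f u = f v) + 2 * (H.card * N) := by
    rw [hNdef]; exact_mod_cast hsplit
  have hmN : m ≤ N := by nlinarith
  have g1 : ε / 12 * N * m ≤ ε / 12 * N * N := by gcongr
  have g2 : (H.card : ℝ) * N ≤ ε / 12 * N * N := by gcongr
  have g3 : 0 ≤ ε * N ^ 2 := by positivity
  nlinarith

theorem key_bound {V : Type*} [DecidableEq V] [Fintype V] (G : SimpleGraph V) [DecidableRel G.Adj] {p : ℕ} (hp : 2 ≤ p)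
    (ε : ℝ) (hN : 0 < Fintype.card V) (hε0 : 0 < ε)
    (hdeg : ∀ v, (1 - 1 / ((p : ℝ) - 1) - ε / 2) * Fintype.card V ≤ (fdeg G v : ℝ))
    (hK : (clq G p Finset.univ : ℝ) ≤ p.factorial * (((p : ℝ) ^ (10 * p))⁻¹ * ε * (Fintype.card V : ℝ) ^ p))
    (f : V → Fin (p - 1)) (hmin : ∀ g : V → Fin (p - 1), mono G f ≤ mono G g) :
    (mono G f : ℝ) ≤ (1 / 2 + 1 / (p : ℝ)) * ε * (Fintype.card V : ℝ) ^ 2 ∧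
    (mono G f : ℝ) ≤ 5 / 6 * ε * (Fintype.card V : ℝ) ^ 2 := by
  have hpos : 0 ≤ ε * (Fintype.card V : ℝ) ^ 2 := by positivity
  rcases Nat.eq_or_lt_of_le hp with h2 | h3
  · subst h2
    have h1 : mono G f ≤ clq G 2 Finset.univ := by
      have : clq G 2 Finset.univ = pc Finset.univ Finset.univ (fun u v => G.Adj u v) := by
        simp [clq, pc]
      rw [this]
      exact pc_mono _ _ _ _ (fun u _ v _ h => h.1)
    have h1' : (mono G f : ℝ) ≤ clq G 2 Finset.univ := by exact_mod_cast h1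
    have h4 : (mono G f : ℝ) ≤ 1 / 2 * (ε * (Fintype.card V : ℝ) ^ 2) := by
      refine (h1'.trans hK).trans ?_
      norm_num [Nat.factorial]
      nlinarith
    constructor
    · push_cast; nlinarith
    · nlinarith
  · have hP : (3 : ℝ) ≤ p := by exact_mod_cast h3
    have hPinv : 1 / (p : ℝ) ≤ 1 / 3 := one_div_le_one_div_of_le (by norm_num) hP
    have main : (mono G f : ℝ) ≤ (1 / 2 + 1 / (p : ℝ)) * ε * (Fintype.card V : ℝ) ^ 2 := by
      rcases le_total ((p : ℝ) ^ 6)⁻¹ ε with h | h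
      · obtain ⟨g, hg⟩ := rough G h3 ε hN h hdeg hK
        exact le_trans (by exact_mod_cast hmin g) hg
      · have hI : (mono G f : ℝ) ≤ (1 / 2 + 1 / (p : ℝ)) * ((p : ℝ) ^ 6)⁻¹ * (Fintype.card V : ℝ) ^ 2 := by
          obtain ⟨g, hg⟩ := rough G h3 ((p : ℝ) ^ 6)⁻¹ hN le_rfl
            (fun v => le_trans (by gcongr) (hdeg v)) (hK.trans (by gcongr))
          exact le_trans (by exact_mod_cast hmin g) hg
        have := boot G h3 ε hN hε0 h hdeg hK f hI (min_switch G f hmin)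
        refine this.trans ?_
        have : 0 ≤ 1 / (p : ℝ) := by positivity
        nlinarith
    refine ⟨main, main.trans ?_⟩
    have : 1 / 2 + 1 / (p : ℝ) ≤ 5 / 6 := by linarith
    gcongr

theorem sum_edgesIn_le {V : Type*} [DecidableEq V] [Fintype V] (G : SimpleGraph V) [DecidableRel G.Adj] {n : ℕ} (f : V → Fin n) :
    2 * ∑ i, edgesIn G (f ⁻¹' {i}) ≤ mono G f := by
  let G' : SimpleGraph V :=
    { Adj := fun u v => G.Adj u v ∧ f u = f v
      symm := ⟨fun u v h => ⟨h.1.symm, h.2.symm⟩⟩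
      loopless := ⟨fun u h => G.loopless.irrefl u h.1⟩ }
  have hadj : ∀ u v, G'.Adj u v ↔ G.Adj u v ∧ f u = f v := fun _ _ => Iff.rfl
  classical
  have h1 := G'.sum_degrees_eq_twice_card_edges
  have h2 : ∑ v, G'.degree v = mono G f := by
    unfold mono pc
    apply Finset.sum_congr rfl
    intro v _
    rw [← SimpleGraph.card_neighborFinset_eq_degree]
    congr 1
    ext w
    simp [hadj]
  rw [← h2, h1]
  apply Nat.mul_le_mul_left
  have h3 : ∀ i, edgesIn G (f ⁻¹' {i}) = (Finset.univ.filter (fun e : Sym2 V => e ∈ G.edgeSet ∧ ∀ v ∈ e, v ∈ f ⁻¹' {i})).card := by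
    intro i
    unfold edgesIn
    rw [← Set.ncard_coe_finset]
    congr 1
    ext e; simp
  simp only [h3]
  rw [← Finset.card_biUnion]
  · apply Finset.card_le_card
    intro e he
    simp only [Finset.mem_biUnion, Finset.mem_univ, Finset.mem_filter, true_and] at he
    obtain ⟨i, he, hv⟩ := he
    rw [SimpleGraph.mem_edgeFinset]
    induction e using Sym2.ind with
    | _ a b =>
      rw [SimpleGraph.mem_edgeSet] at he ⊢
      have ha : f a = i := hv a (by simp)
      have hb : f b = i := hv b (by simp)
      exact ⟨he, ha.trans hb.symm⟩
  · intro i _ j _ hij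
    rw [Function.onFun, Finset.disjoint_left]
    intro e he he'
    simp only [Finset.mem_univ, Finset.mem_filter, true_and] at he he'
    induction e using Sym2.ind with
    | _ a b =>
      have ha : f a = i := he.2 a (by simp)
      have hb : f a = j := he'.2 a (by simp)
      exact hij (ha.symm.trans hb)

theorem csz_eq {V : Type*} [Fintype V] {n : ℕ} (f : V → Fin n) (i : Fin n) :
    (f ⁻¹' {i}).ncard = csz f i := by
  unfold csz
  rw [← Set.ncard_coe_finset]
  congr 1
  ext e; simp

theorem degIn_eq {V : Type*} [Fintype V] (G : SimpleGraph V) [DecidableRel G.Adj] {n : ℕ} (f : V → Fin n) (i : Fin n) (v : V) :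
    degIn G (f ⁻¹' {i}) v = cdeg G f i v := by
  unfold cdeg degIn
  rw [← Set.ncard_coe_finset]
  congr 1
  ext e; simp

theorem edgesBetween_ge {V : Type*} [DecidableEq V] [Fintype V] (G : SimpleGraph V) [DecidableRel G.Adj] {n : ℕ} (f : V → Fin n)
    (i j : Fin n) (hij : i ≠ j) :
    2 * (csz f i * csz f j) ≤ miss G f + 2 * edgesBetween G (f ⁻¹' {i}) (f ⁻¹' {j}) := by
  set A := Finset.univ.filter (fun v => f v = i) with hA
  set B := Finset.univ.filter (fun v => f v = j) with hB
  have mA : ∀ v ∈ A, f v = i := fun v hv => (Finset.mem_filter.mp hv).2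
  have mB : ∀ v ∈ B, f v = j := fun v hv => (Finset.mem_filter.mp hv).2
  have hdis : Disjoint A B := by
    rw [Finset.disjoint_left]
    intro v h1 h2
    exact hij ((mA v h1).symm.trans (mB v h2))
  have h1 : edgesBetween G (f ⁻¹' {i}) (f ⁻¹' {j}) = pc A B (fun u v => G.Adj u v) := by
    unfold pc edgesBetween
    rw [← Finset.card_sigma, ← Finset.card_map (Equiv.sigmaEquivProd V V).toEmbedding, ← Set.ncard_coe_finset]
    congr 1
    ext ⟨a, b⟩
    simp [hA, hB, Equiv.sigmaEquivProd]
  have h2 := pc_split A B (fun _ _ => True) (fun u v => G.Adj u v)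
  rw [pc_full A B (fun _ _ => True) (by simp)] at h2
  have h3 : pc A B (fun u v => True ∧ G.Adj u v) = pc A B (fun u v => G.Adj u v) := pc_congr _ _ _ _ (by simp)
  have h4 : pc A B (fun u v => True ∧ ¬ G.Adj u v) = pc A B (fun u v => f u ≠ f v ∧ ¬ G.Adj u v) := by
    apply pc_congr
    intro u hu v hv
    simp [mA u hu, mB v hv, hij]
  have h5 : 2 * pc A B (fun u v => f u ≠ f v ∧ ¬ G.Adj u v) ≤ miss G f := by
    have e1 : pc A Finset.univ (fun u v => f u ≠ f v ∧ ¬ G.Adj u v) + pc B Finset.univ (fun u v => f u ≠ f v ∧ ¬ G.Adj u v) ≤ miss G f := by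
      rw [← pc_union_left _ _ _ hdis]
      exact Finset.sum_le_sum_of_subset (Finset.subset_univ _)
    have mono_r : ∀ X Y : Finset V, pc X Y (fun u v => f u ≠ f v ∧ ¬ G.Adj u v) ≤ pc X Finset.univ (fun u v => f u ≠ f v ∧ ¬ G.Adj u v) := by
      intro X Y
      exact Finset.sum_le_sum (fun u _ => Finset.card_le_card (Finset.filter_subset_filter _ (Finset.subset_univ _)))
    have e2 := mono_r A B
    have e3 := mono_r B A
    rw [pc_symm B A _ (fun u v h => ⟨h.1.symm, fun h' => h.2 h'.symm⟩)] at e3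
    omega
  have h6 : csz f i * csz f j = A.card * B.card := rfl
  omega

/-- Lemma 4.2, Fox–He–Wigderson stability-supersaturation:
a graph with minimum degree at least `(1 - 1/(p-1) - γ)N` and at most `ηN^p` copies of `K_p`
admits a partition into `p-1` parts (the fibers of `f`) satisfying (i)–(iv). -/
theorem stability_supersaturation (ε : ℝ) (hε : 0 < ε) (p : ℕ) (hp : 2 ≤ p)
    (N : ℕ) (hN : 10 ≤ N) (Γ : SimpleGraph (Fin N))
    (hmindeg : ∀ v : Fin N,
      ((1 - 1 / ((p : ℝ) - 1) - min (1 / (2 * (p : ℝ) ^ 2)) (ε / 2)) * N : ℝ) ≤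
        {w | Γ.Adj v w}.ncard)
    (hcliques : ({t : Finset (Fin N) | Γ.IsNClique p t}.ncard : ℝ) ≤
      ((p : ℝ) ^ (10 * p))⁻¹ * ε * N ^ p) :
    ∃ f : Fin N → Fin (p - 1),
      ((∑ i : Fin (p - 1), edgesIn Γ (f ⁻¹' {i}) : ℕ) : ℝ) ≤ ε * (N.choose 2) ∧
      (∀ i : Fin (p - 1),
        |((f ⁻¹' {i} : Set (Fin N)).ncard : ℝ) - (N : ℝ) / ((p : ℝ) - 1)| ≤
          Real.sqrt (2 * ε) * N) ∧
      (∀ i j : Fin (p - 1), i ≠ j →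
        ((1 - (p : ℝ) ^ 2 * ε) * ((f ⁻¹' {i} : Set (Fin N)).ncard : ℝ) *
            ((f ⁻¹' {j} : Set (Fin N)).ncard : ℝ) ≤
          (edgesBetween Γ (f ⁻¹' {i}) (f ⁻¹' {j}) : ℝ))) ∧
      (∀ i j : Fin (p - 1), ∀ v ∈ f ⁻¹' {i},
        degIn Γ (f ⁻¹' {i}) v ≤ degIn Γ (f ⁻¹' {j}) v) := by
  classical
  have hP : (2 : ℝ) ≤ p := by exact_mod_cast hp
  have hn : (0 : ℝ) < N := by exact_mod_cast (by omega : 0 < N)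
  have hN10 : (10 : ℝ) ≤ N := by exact_mod_cast hN
  have hcard : Fintype.card (Fin N) = N := Fintype.card_fin N
  have hdeg : ∀ v, (1 - 1 / ((p : ℝ) - 1) - ε / 2) * Fintype.card (Fin N) ≤ (fdeg Γ v : ℝ) := by
    intro v
    rw [hcard]
    have h1 : ({w | Γ.Adj v w}.ncard) = fdeg Γ v := by
      unfold fdeg
      rw [← Set.ncard_coe_finset]
      congr 1
      ext e; simp
    rw [← h1]
    refine le_trans ?_ (hmindeg v)
    gcongr
    exact min_le_right _ _
  have hK : (clq Γ p Finset.univ : ℝ) ≤ p.factorial * (((p : ℝ) ^ (10 * p))⁻¹ * ε * (Fintype.card (Fin N) : ℝ) ^ p) := by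
    have h1 := clq_le Γ p Finset.univ
    have h2 : ({t : Finset (Fin N) | Γ.IsNClique p t}.ncard) = ((Finset.univ : Finset (Fin N)).powerset.filter (fun t => Γ.IsNClique p t)).card := by
      rw [← Set.ncard_coe_finset]
      congr 1
      ext e; simp
    rw [← h2] at h1
    have h1' : (clq Γ p Finset.univ : ℝ) ≤ p.factorial * ({t : Finset (Fin N) | Γ.IsNClique p t}.ncard : ℝ) := by
      exact_mod_cast h1
    refine h1'.trans ?_
    rw [hcard]
    gcongr
  have hne : Nonempty (Fin N → Fin (p - 1)) := ⟨fun _ => ⟨0, by omega⟩⟩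
  obtain ⟨f, hf⟩ := Finite.exists_min (fun f : Fin N → Fin (p - 1) => mono Γ f)
  obtain ⟨hb1, hb2⟩ := key_bound Γ hp ε (by rw [hcard]; omega) hε hdeg hK f hf
  have hst := struct_ineq Γ hp f _ hdeg
  rw [hcard] at hb1 hb2 hst
  have hPinv : 1 / (p : ℝ) ≤ 1 / 2 := one_div_le_one_div_of_le (by norm_num) hP
  have hεN : 0 < ε * (N : ℝ) ^ 2 := by positivity
  have hst2 : ∑ i, ((csz f i : ℝ) - N / ((p : ℝ) - 1)) ^ 2 + miss Γ f ≤ (1 + 1 / (p : ℝ)) * (ε * (N : ℝ) ^ 2) := by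
    nlinarith
  have hmiss0 : (0 : ℝ) ≤ miss Γ f := Nat.cast_nonneg _
  refine ⟨f, ?_, ?_, ?_, ?_⟩
  · have h1 : (2 : ℝ) * ((∑ i : Fin (p - 1), edgesIn Γ (f ⁻¹' {i}) : ℕ) : ℝ) ≤ mono Γ f := by
      exact_mod_cast sum_edgesIn_le Γ f
    rw [Nat.cast_choose_two]
    have h2 : 5 / 6 * (N : ℝ) ^ 2 ≤ N * (N - 1) := by nlinarith
    have h3 : 5 / 6 * ε * (N : ℝ) ^ 2 ≤ ε * (N * (N - 1)) := by nlinarith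
    linarith
  · intro i
    rw [csz_eq]
    have h1 : ((csz f i : ℝ) - N / ((p : ℝ) - 1)) ^ 2 ≤ ∑ i, ((csz f i : ℝ) - N / ((p : ℝ) - 1)) ^ 2 :=
      Finset.single_le_sum (f := fun i => ((csz f i : ℝ) - N / ((p : ℝ) - 1)) ^ 2) (fun _ _ => sq_nonneg _) (Finset.mem_univ i)
    apply abs_le_of_sq_le_sq _ (by positivity)
    rw [mul_pow, Real.sq_sqrt (by positivity)]
    nlinarith
  · intro i j hij
    rw [csz_eq, csz_eq]
    set a : ℝ := (csz f i : ℝ) with ha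
    set b : ℝ := (csz f j : ℝ) with hb
    have ha0 : 0 ≤ a := Nat.cast_nonneg _
    have hb0 : 0 ≤ b := Nat.cast_nonneg _
    have he := edgesBetween_ge Γ f i j hij
    have he' : 2 * (a * b) ≤ miss Γ f + 2 * (edgesBetween Γ (f ⁻¹' {i}) (f ⁻¹' {j}) : ℝ) := by
      rw [ha, hb]; exact_mod_cast he
    set e : ℝ := (edgesBetween Γ (f ⁻¹' {i}) (f ⁻¹' {j}) : ℝ) with hedef
    have he0 : 0 ≤ e := Nat.cast_nonneg _
    rcases le_total 1 ((p : ℝ) ^ 2 * ε) with hθ | hθ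
    · have : (1 - (p : ℝ) ^ 2 * ε) * a * b ≤ 0 := by
        have : 0 ≤ a * b := by positivity
        nlinarith
      linarith
    · have h1 : (a - N / ((p : ℝ) - 1)) ^ 2 + (b - N / ((p : ℝ) - 1)) ^ 2 ≤ ∑ i, ((csz f i : ℝ) - N / ((p : ℝ) - 1)) ^ 2 := by
        rw [← Finset.sum_pair (f := fun i => ((csz f i : ℝ) - N / ((p : ℝ) - 1)) ^ 2) hij]
        exact Finset.sum_le_sum_of_subset_of_nonneg (Finset.subset_univ _) (fun _ _ _ => sq_nonneg _)
      set t : ℝ := N / ((p : ℝ) - 1) with ht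
      set θ : ℝ := (p : ℝ) ^ 2 * ε with hθdef
      have hθ0 : 0 < θ := by positivity
      have htN : t * ((p : ℝ) - 1) = N := by rw [ht]; field_simp [show (p : ℝ) - 1 ≠ 0 by linarith]
      -- (1+1/p) ε N² ≤ θ t²
      have h2 : (1 + 1 / (p : ℝ)) * (ε * (N : ℝ) ^ 2) ≤ θ * t ^ 2 := by
        have h3 : (1 + 1 / (p : ℝ)) * ((p : ℝ) - 1) ^ 2 ≤ (p : ℝ) ^ 2 := by
          have : (1 + 1 / (p : ℝ)) * ((p : ℝ) - 1) ^ 2 = (p : ℝ) ^ 2 - p - 1 + 1 / p := by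
            field_simp; ring
          rw [this]; linarith
        calc (1 + 1 / (p : ℝ)) * (ε * (N : ℝ) ^ 2) = ((1 + 1 / (p : ℝ)) * ((p : ℝ) - 1) ^ 2) * (ε * t ^ 2) := by
              rw [← htN]; ring
          _ ≤ (p : ℝ) ^ 2 * (ε * t ^ 2) := by gcongr
          _ = _ := by rw [hθdef]; ring
      have h4 : θ * ((a - t) ^ 2 + (b - t) ^ 2) ≤ (a - t) ^ 2 + (b - t) ^ 2 := by
        have : 0 ≤ (a - t) ^ 2 + (b - t) ^ 2 := by positivity
        nlinarith
      have h5 : 0 ≤ θ * (a + b - t) ^ 2 := by positivity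
      have h6 : θ * t ^ 2 - θ * ((a - t) ^ 2 + (b - t) ^ 2) - 2 * (θ * (a * b)) = - (θ * (a + b - t) ^ 2) := by ring
      have h7 : (1 - θ) * a * b = a * b - θ * (a * b) := by ring
      rw [h7]
      linarith
  · intro i j v hv
    have hv : f v = i := hv
    rw [degIn_eq, degIn_eq, ← hv]
    exact min_switch Γ f hf v j
end

section
/- For all integers p ≥ 1 and t with t ≥ p², the binomial coefficient satisfies C(t, p) ≥ t^p / (p! · e), where e is Euler's number. -/
/-- for `t ≥ p²`, `C(t, p) ≥ t^p / (p!·e)`. -/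
theorem choose_ge_pow_div_factorial_exp (p t : ℕ) (hp : 1 ≤ p) (ht : p ^ 2 ≤ t) :
    (t : ℝ) ^ p / (p.factorial * Real.exp 1) ≤ (t.choose p : ℝ) := by
  have hpt : p ≤ t := by nlinarith
  have h1 : (t + 1 - p) ^ p ≤ p.factorial * t.choose p := by
    rw [← Nat.descFactorial_eq_factorial_mul_choose]
    exact Nat.pow_sub_le_descFactorial t p
  obtain ⟨s, hs⟩ : ∃ s, s = t + 1 - p := ⟨_, rfl⟩
  rw [← hs] at h1
  have h2 : (t : ℝ) + 1 = s + p := by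
    have : t + 1 = s + p := by omega
    exact_mod_cast this
  have h1' : (s : ℝ) ^ p ≤ p.factorial * t.choose p := by exact_mod_cast h1
  have ht' : (p : ℝ) ^ 2 ≤ t := by exact_mod_cast ht
  have hp' : (0 : ℝ) < p := by exact_mod_cast hp
  have h3 : (t : ℝ) ≤ s * Real.exp (1 / p) := by
    have h4 : (t : ℝ) ≤ s * (1 / p + 1) := by
      have h5 : (p : ℝ) - 1 ≤ s / p := by
        rw [le_div_iff₀ hp']
        nlinarith
      have h6 : (s : ℝ) * (1 / p + 1) = s / p + s := by ring
      rw [h6]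
      linarith
    exact h4.trans (mul_le_mul_of_nonneg_left (Real.add_one_le_exp _) (Nat.cast_nonneg s))
  have h7 : (t : ℝ) ^ p ≤ s ^ p * Real.exp 1 := by
    have h8 := pow_le_pow_left₀ (Nat.cast_nonneg t) h3 p
    rw [mul_pow, ← Real.exp_nat_mul, mul_one_div_cancel hp'.ne'] at h8
    exact h8
  rw [div_le_iff₀ (by positivity)]
  calc (t : ℝ) ^ p ≤ s ^ p * Real.exp 1 := h7
    _ ≤ (p.factorial * t.choose p) * Real.exp 1 :=
      mul_le_mul_of_nonneg_right h1' (Real.exp_pos 1).le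
    _ = _ := by ring
end
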